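/- Assume θ̇ has compact support. If the tube is twisted, then μ(s) > 1/4 for every s ∈ [0,∞). Conversely, if the tube is untwisted (θ is constant on ℝ or ω is invariant under every rotation about the origin), then μ(s) = 1/4 for every s ∈ [0,∞). -/

import Mathlib

open MeasureTheory Real Set Filter

noncomputable section

/-- First partial derivative ∂₁ of a function on ℝ³ = ℝ × ℝ × ℝ. -/
def pd1 {E : Type*} [NormedAddCommGroup E] [NormedSpace ℝ E]
    (ψ : ℝ × ℝ × ℝ → E) (x : ℝ × ℝ × ℝ) : E :=
  deriv (fun t => ψ (t, x.2.1, x.2.2)) x.1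

/-- Second partial derivative ∂₂. -/
def pd2 {E : Type*} [NormedAddCommGroup E] [NormedSpace ℝ E]
    (ψ : ℝ × ℝ × ℝ → E) (x : ℝ × ℝ × ℝ) : E :=
  deriv (fun t => ψ (x.1, t, x.2.2)) x.2.1

/-- Third partial derivative ∂₃. -/
def pd3 {E : Type*} [NormedAddCommGroup E] [NormedSpace ℝ E]
    (ψ : ℝ × ℝ × ℝ → E) (x : ℝ × ℝ × ℝ) : E :=
  deriv (fun t => ψ (x.1, x.2.1, t)) x.2.2

/-- Transverse angular derivative ∂_τ = x₃∂₂ − x₂∂₃. -/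
def pdtau {E : Type*} [NormedAddCommGroup E] [NormedSpace ℝ E]
    (ψ : ℝ × ℝ × ℝ → E) (x : ℝ × ℝ × ℝ) : E :=
  x.2.2 • pd2 ψ x - x.2.1 • pd3 ψ x

/-- The straight tube Ω₀ = ℝ × ω. -/
def Omega0 (ω : Set (ℝ × ℝ)) : Set (ℝ × ℝ × ℝ) := {x | x.2 ∈ ω}

/-- Smooth compactly supported test functions with support in Ω (i.e. C_c^∞(Ω)). -/
def IsTest3 {E : Type*} [NormedAddCommGroup E] [NormedSpace ℝ E]
    (Ω : Set (ℝ × ℝ × ℝ)) (ψ : ℝ × ℝ × ℝ → E) : Prop :=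
  ContDiff ℝ (⊤ : ℕ∞) ψ ∧ HasCompactSupport ψ ∧ tsupport ψ ⊆ Ω

/-- Partial derivatives on ℝ². -/
def pd1' (f : ℝ × ℝ → ℂ) (p : ℝ × ℝ) : ℂ := deriv (fun t => f (t, p.2)) p.1

def pd2' (f : ℝ × ℝ → ℂ) (p : ℝ × ℝ) : ℂ := deriv (fun t => f (p.1, t)) p.2

/-- Smooth compactly supported test functions on the cross-section, C_c^∞(ω). -/
def IsTest2 (ω : Set (ℝ × ℝ)) (f : ℝ × ℝ → ℂ) : Prop :=
  ContDiff ℝ (⊤ : ℕ∞) f ∧ HasCompactSupport f ∧ tsupport f ⊆ ω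

/-- The lowest Dirichlet eigenvalue E₁ of −Δ on ω, defined variationally. -/
def E1 (ω : Set (ℝ × ℝ)) : ℝ :=
  sInf { r : ℝ | ∃ f : ℝ × ℝ → ℂ, IsTest2 ω f ∧ f ≠ 0 ∧
    r = (∫ p in ω, (‖pd1' f p‖ ^ 2 + ‖pd2' f p‖ ^ 2)) / ∫ p in ω, ‖f p‖ ^ 2 }

/-- The twisted quadratic form Q_θ[ψ] = ∫_{Ω₀} (|∂₁ψ − θ̇ ∂_τψ|² + |∇'ψ|²). -/
def Qform (θ : ℝ → ℝ) (ω : Set (ℝ × ℝ)) (ψ : ℝ × ℝ × ℝ → ℂ) : ℝ :=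
  ∫ x in Omega0 ω,
    (‖pd1 ψ x - deriv θ x.1 • pdtau ψ x‖ ^ 2 + ‖pd2 ψ x‖ ^ 2 + ‖pd3 ψ x‖ ^ 2)

/-- Rotation of the plane by angle ϑ about the origin. -/
def rot (ϑ : ℝ) (p : ℝ × ℝ) : ℝ × ℝ :=
  (p.1 * Real.cos ϑ + p.2 * Real.sin ϑ, -p.1 * Real.sin ϑ + p.2 * Real.cos ϑ)

/-- The tube is twisted: θ is not constant and ω is not rotationally symmetric about
the origin (in the strong sense: some rotated copy of ω differs from ω on a set of
positive Lebesgue measure). -/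
def Twisted (θ : ℝ → ℝ) (ω : Set (ℝ × ℝ)) : Prop :=
  (∃ s t : ℝ, θ s ≠ θ t) ∧
  (∃ ϑ ∈ Set.Ioo (0 : ℝ) (2 * Real.pi), volume (symmDiff (rot ϑ '' ω) ω) ≠ 0)

/-- The tube is untwisted: θ is constant or ω is invariant under every rotation
about the origin. -/
def Untwisted (θ : ℝ → ℝ) (ω : Set (ℝ × ℝ)) : Prop :=
  (∀ s t : ℝ, θ s = θ t) ∨ (∀ ϑ : ℝ, rot ϑ '' ω = ω)

/-- σ_s(y₁) = e^{s/2} θ̇(e^{s/2} y₁). -/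
def sigmafun (θ : ℝ → ℝ) (s y₁ : ℝ) : ℝ :=
  Real.exp (s / 2) * deriv θ (Real.exp (s / 2) * y₁)

/-- The quadratic form J_s of the generator of the self-similar evolution:
J_s[v] = ∫|∂₁v − σ_s ∂_τv|² + (1/16)∫ y₁²|v|² + e^s ( ∫|∇'v|² − E₁∫|v|² ). -/
def Jform (θ : ℝ → ℝ) (ω : Set (ℝ × ℝ)) (s : ℝ) (v : ℝ × ℝ × ℝ → ℂ) : ℝ :=
  (∫ y in Omega0 ω, ‖pd1 v y - sigmafun θ s y.1 • pdtau v y‖ ^ 2)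
    + (1 / 16) * (∫ y in Omega0 ω, y.1 ^ 2 * ‖v y‖ ^ 2)
    + Real.exp s * ((∫ y in Omega0 ω, (‖pd2 v y‖ ^ 2 + ‖pd3 v y‖ ^ 2))
        - E1 ω * ∫ y in Omega0 ω, ‖v y‖ ^ 2)

/-- μ(s): the lowest point of the spectrum of the generator of the self-similar
evolution, defined variationally over nonzero v ∈ C_c^∞(Ω₀). -/
def mu (θ : ℝ → ℝ) (ω : Set (ℝ × ℝ)) (s : ℝ) : ℝ :=
  sInf { r : ℝ | ∃ v : ℝ × ℝ × ℝ → ℂ, IsTest3 (Omega0 ω) v ∧ v ≠ 0 ∧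
    r = Jform θ ω s v / ∫ y in Omega0 ω, ‖v y‖ ^ 2 }

lemma sq_setIntegral_le {a b : ℝ} (hab : a ≤ b) {u : ℝ → ℝ} (hu : Continuous u) :
    (∫ t in Icc a b, u t) ^ 2 ≤ (b - a) * ∫ t in Icc a b, u t ^ 2 := by
  set I := ∫ t in Icc a b, u t with hI
  have h1 : IntegrableOn u (Icc a b) := hu.continuousOn.integrableOn_Icc
  have h2 : IntegrableOn (fun t => u t ^ 2) (Icc a b) :=
    (hu.pow 2).continuousOn.integrableOn_Icc
  rcases hab.eq_or_lt with rfl | hlt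
  · have : I = 0 := by simp [hI]
    simp [this]
  have h0 : 0 ≤ ∫ t in Icc a b, ((b - a) * u t - I) ^ 2 :=
    integral_nonneg fun t => sq_nonneg _
  have h3 : ∫ t in Icc a b, ((b - a) * u t - I) ^ 2
      = (b - a) ^ 2 * (∫ t in Icc a b, u t ^ 2) - 2 * (b - a) * I * I + (b - a) * I ^ 2 := by
    have : ∀ t, ((b - a) * u t - I) ^ 2
        = ((b - a) ^ 2 * u t ^ 2 - 2 * (b - a) * I * u t) + I ^ 2 := fun t => by ring
    simp_rw [this]
    rw [integral_add, integral_sub, integral_const_mul, integral_const_mul]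
    · simp [hab, ← hI]
    · exact h2.const_mul _
    · exact h1.const_mul _
    · exact (h2.const_mul _).sub (h1.const_mul _)
    · exact (continuous_const).continuousOn.integrableOn_Icc
  rw [h3] at h0
  have : 0 ≤ (b - a) * ((b - a) * (∫ t in Icc a b, u t ^ 2) - I ^ 2) := by nlinarith
  have := nonneg_of_mul_nonneg_right this (sub_pos.2 hlt)
  linarith

lemma sq_norm_sub_le {E : Type*} [NormedAddCommGroup E] [NormedSpace ℝ E] [CompleteSpace E]
    {φ φ' : ℝ → E} {a b x y : ℝ} (hx : x ∈ Icc a b) (hy : y ∈ Icc a b)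
    (hφ : ∀ t, HasDerivAt φ (φ' t) t) (hc : Continuous φ') :
    ‖φ x - φ y‖ ^ 2 ≤ (b - a) * ∫ t in Icc a b, ‖φ' t‖ ^ 2 := by
  have h1 : ∫ t in y..x, φ' t = φ x - φ y :=
    intervalIntegral.integral_eq_sub_of_hasDerivAt (fun t _ => hφ t) (hc.intervalIntegrable _ _)
  have h2 : ‖φ x - φ y‖ ≤ ∫ t in Icc a b, ‖φ' t‖ := by
    rw [← h1]
    refine intervalIntegral.norm_integral_le_integral_norm_uIoc.trans ?_
    refine setIntegral_mono_set hc.norm.continuousOn.integrableOn_Icc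
      (Eventually.of_forall fun t => norm_nonneg _) ?_
    exact (uIoc_subset_uIcc.trans (uIcc_subset_Icc hy hx)).eventuallyLE
  refine le_trans ?_ (sq_setIntegral_le (hx.1.trans hx.2) hc.norm)
  gcongr

lemma HasCompactSupport.norm_sq {X F : Type*} [NormedAddCommGroup F] [TopologicalSpace X] {f : X → F}
    (hf : HasCompactSupport f) :
    HasCompactSupport fun x => ‖f x‖ ^ 2 :=
  hf.comp_left (g := fun z => ‖z‖ ^ 2) (by simp)

lemma integrable_norm_sq {X F : Type*} [NormedAddCommGroup F] [TopologicalSpace X] [MeasurableSpace X]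
    [OpensMeasurableSpace X] {μ : Measure X} [IsFiniteMeasureOnCompacts μ]
    {f : X → F} (hf : Continuous f) (hc : HasCompactSupport f) :
    Integrable (fun x => ‖f x‖ ^ 2) μ :=
  (hf.norm.pow 2).integrable_of_hasCompactSupport hc.norm_sq

/-- Partial derivatives of a function on the plane, as directional derivatives. -/
def dx {F : Type*} [NormedAddCommGroup F] [NormedSpace ℝ F] (f : ℝ × ℝ → F) (p : ℝ × ℝ) : F :=
  fderiv ℝ f p (1, 0)

def dy {F : Type*} [NormedAddCommGroup F] [NormedSpace ℝ F] (f : ℝ × ℝ → F) (p : ℝ × ℝ) : F :=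
  fderiv ℝ f p (0, 1)

/-- Smooth functions compactly supported in a planar set. -/
structure PlaneTest {F : Type*} [NormedAddCommGroup F] [NormedSpace ℝ F]
    (ω : Set (ℝ × ℝ)) (f : ℝ × ℝ → F) : Prop where
  smooth : ContDiff ℝ (⊤ : ℕ∞) f
  compact : HasCompactSupport f
  supp : tsupport f ⊆ ω

section
variable {F : Type*} [NormedAddCommGroup F] [NormedSpace ℝ F] {f : ℝ × ℝ → F} {ω : Set (ℝ × ℝ)}

lemma hasDerivAt_dx (hf : Differentiable ℝ f) (x y : ℝ) :
    HasDerivAt (fun t => f (t, y)) (dx f (x, y)) x := by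
  have h : HasDerivAt (fun t : ℝ => (t, y)) ((1 : ℝ), (0 : ℝ)) x :=
    (hasDerivAt_id x).prodMk (hasDerivAt_const x y)
  exact (hf (x, y)).hasFDerivAt.comp_hasDerivAt x h

lemma hasDerivAt_dy (hf : Differentiable ℝ f) (x y : ℝ) :
    HasDerivAt (fun t => f (x, t)) (dy f (x, y)) y := by
  have h : HasDerivAt (fun t : ℝ => (x, t)) ((0 : ℝ), (1 : ℝ)) y :=
    (hasDerivAt_const y x).prodMk (hasDerivAt_id y)
  exact (hf (x, y)).hasFDerivAt.comp_hasDerivAt y h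

lemma pd1'_eq {f : ℝ × ℝ → ℂ} (hf : Differentiable ℝ f) : pd1' f = dx f :=
  funext fun p => (hasDerivAt_dx hf p.1 p.2).deriv

lemma pd2'_eq {f : ℝ × ℝ → ℂ} (hf : Differentiable ℝ f) : pd2' f = dy f :=
  funext fun p => (hasDerivAt_dy hf p.1 p.2).deriv

lemma PlaneTest.diff (hf : PlaneTest ω f) : Differentiable ℝ f :=
  hf.smooth.differentiable (by simp)

lemma PlaneTest.continuous (hf : PlaneTest ω f) : Continuous f := hf.smooth.continuous

lemma PlaneTest.continuous_dx (hf : PlaneTest ω f) : Continuous (dx f) :=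
  (hf.smooth.continuous_fderiv (by simp)).clm_apply continuous_const

lemma PlaneTest.continuous_dy (hf : PlaneTest ω f) : Continuous (dy f) :=
  (hf.smooth.continuous_fderiv (by simp)).clm_apply continuous_const

lemma PlaneTest.compact_dx (hf : PlaneTest ω f) : HasCompactSupport (dx f) :=
  hf.compact.fderiv_apply ℝ _

lemma PlaneTest.compact_dy (hf : PlaneTest ω f) : HasCompactSupport (dy f) :=
  hf.compact.fderiv_apply ℝ _

lemma PlaneTest.zero_of_notMem (hf : PlaneTest ω f) {p : ℝ × ℝ} (hp : p ∉ ω) : f p = 0 :=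
  image_eq_zero_of_notMem_tsupport fun h => hp (hf.supp h)

lemma PlaneTest.dx_zero_of_notMem (hf : PlaneTest ω f) {p : ℝ × ℝ} (hp : p ∉ ω) : dx f p = 0 := by
  have : fderiv ℝ f p = 0 := image_eq_zero_of_notMem_tsupport
    fun h => hp (hf.supp (tsupport_fderiv_subset ℝ h))
  simp [dx, this]

lemma PlaneTest.dy_zero_of_notMem (hf : PlaneTest ω f) {p : ℝ × ℝ} (hp : p ∉ ω) : dy f p = 0 := by
  have : fderiv ℝ f p = 0 := image_eq_zero_of_notMem_tsupport
    fun h => hp (hf.supp (tsupport_fderiv_subset ℝ h))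
  simp [dy, this]

/-- The shifted Dirichlet energy. -/
def excess (ω : Set (ℝ × ℝ)) (f : ℝ × ℝ → F) : ℝ :=
  (∫ p, (‖dx f p‖ ^ 2 + ‖dy f p‖ ^ 2)) - E1 ω * ∫ p, ‖f p‖ ^ 2

lemma PlaneTest.integrable (hf : PlaneTest ω f) : Integrable (fun p => ‖f p‖ ^ 2) :=
  integrable_norm_sq hf.continuous hf.compact
lemma PlaneTest.integrable_dx (hf : PlaneTest ω f) : Integrable (fun p => ‖dx f p‖ ^ 2) :=
  integrable_norm_sq hf.continuous_dx hf.compact_dx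
lemma PlaneTest.integrable_dy (hf : PlaneTest ω f) : Integrable (fun p => ‖dy f p‖ ^ 2) :=
  integrable_norm_sq hf.continuous_dy hf.compact_dy

lemma PlaneTest.integral_pos (hf : PlaneTest ω f) (h0 : f ≠ 0) : 0 < ∫ p, ‖f p‖ ^ 2 := by
  obtain ⟨p, hp⟩ := Function.ne_iff.1 h0
  exact (hf.continuous.norm.pow 2).integral_pos_of_hasCompactSupport_nonneg_nonzero
    hf.compact.norm_sq (fun p => by positivity) (x := p) (by simpa using hp)

lemma E1_nonneg (ω : Set (ℝ × ℝ)) : 0 ≤ E1 ω := by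
  refine Real.sInf_nonneg ?_
  rintro r ⟨f, -, -, rfl⟩
  exact div_nonneg (integral_nonneg fun p => by positivity) (integral_nonneg fun p => by positivity)

lemma PlaneTest.rayleigh_eq {f : ℝ × ℝ → ℂ} (hf : PlaneTest ω f) :
    (∫ p in ω, (‖pd1' f p‖ ^ 2 + ‖pd2' f p‖ ^ 2)) / (∫ p in ω, ‖f p‖ ^ 2)
      = (∫ p, (‖dx f p‖ ^ 2 + ‖dy f p‖ ^ 2)) / ∫ p, ‖f p‖ ^ 2 := by
  rw [pd1'_eq hf.diff, pd2'_eq hf.diff,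
    setIntegral_eq_integral_of_forall_compl_eq_zero (fun p hp => by
      simp [hf.dx_zero_of_notMem hp, hf.dy_zero_of_notMem hp]),
    setIntegral_eq_integral_of_forall_compl_eq_zero (fun p hp => by
      simp [hf.zero_of_notMem hp])]

lemma excess_nonneg {f : ℝ × ℝ → ℂ} (hf : PlaneTest ω f) : 0 ≤ excess ω f := by
  by_cases h0 : f = 0
  · subst h0
    have : dx (0 : ℝ × ℝ → ℂ) = 0 := by ext p; simp [dx]
    have : dy (0 : ℝ × ℝ → ℂ) = 0 := by ext p; simp [dy]
    simp [excess, *]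
  have hpos := hf.integral_pos h0
  have : E1 ω ≤ (∫ p, (‖dx f p‖ ^ 2 + ‖dy f p‖ ^ 2)) / ∫ p, ‖f p‖ ^ 2 := by
    refine csInf_le ⟨0, ?_⟩ ⟨f, ⟨hf.smooth, hf.compact, hf.supp⟩, h0, hf.rayleigh_eq.symm⟩
    rintro r ⟨f, -, -, rfl⟩
    exact div_nonneg (integral_nonneg fun p => by positivity)
      (integral_nonneg fun p => by positivity)
  rw [le_div_iff₀ hpos] at this
  unfold excess
  linarith

lemma PlaneTest.ofReal {g : ℝ × ℝ → ℝ} (hg : PlaneTest ω g) :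
    PlaneTest ω (fun p => (g p : ℂ)) where
  smooth := Complex.ofRealCLM.contDiff.comp hg.smooth
  compact := hg.compact.comp_left (g := fun x : ℝ => (x : ℂ)) (by simp)
  supp := (closure_mono (by intro p; simp)).trans hg.supp

lemma dx_ofReal {g : ℝ × ℝ → ℝ} (hg : Differentiable ℝ g) (p : ℝ × ℝ) :
    dx (fun p => (g p : ℂ)) p = ((dx g p : ℝ) : ℂ) := by
  have := (Complex.ofRealCLM.hasFDerivAt.comp p (hg p).hasFDerivAt).fderiv
  change fderiv ℝ (Complex.ofRealCLM ∘ g) p (1, 0) = _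
  rw [this]; rfl

lemma dy_ofReal {g : ℝ × ℝ → ℝ} (hg : Differentiable ℝ g) (p : ℝ × ℝ) :
    dy (fun p => (g p : ℂ)) p = ((dy g p : ℝ) : ℂ) := by
  have := (Complex.ofRealCLM.hasFDerivAt.comp p (hg p).hasFDerivAt).fderiv
  change fderiv ℝ (Complex.ofRealCLM ∘ g) p (0, 1) = _
  rw [this]; rfl

lemma excess_nonneg_real {g : ℝ × ℝ → ℝ} (hg : PlaneTest ω g) : 0 ≤ excess ω g := by
  have := excess_nonneg hg.ofReal
  simpa [excess, dx_ofReal hg.diff, dy_ofReal hg.diff] using this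

end

lemma closedBall_plane (p : ℝ × ℝ) (r : ℝ) :
    Metric.closedBall p r = Icc (p.1 - r) (p.1 + r) ×ˢ Icc (p.2 - r) (p.2 + r) := by
  rw [← Real.closedBall_eq_Icc, ← Real.closedBall_eq_Icc, closedBall_prod_same]

/-- A Poincaré inequality on squares, comparing a superlevel set with a sublevel set. -/
lemma sq_sub_mul_measure_le {h : ℝ × ℝ → ℝ} (hh : ContDiff ℝ (⊤ : ℕ∞) h) {p : ℝ × ℝ} {r : ℝ}
    (hr : 0 < r) {S T : Set (ℝ × ℝ)} (hS : MeasurableSet S) (hT : MeasurableSet T)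
    (hSB : S ⊆ Metric.closedBall p r) (hTB : T ⊆ Metric.closedBall p r) {a b : ℝ} (hab : a ≤ b)
    (ha : ∀ x ∈ S, h x ≤ a) (hb : ∀ x ∈ T, b ≤ h x) :
    (b - a) ^ 2 * volume.real T * volume.real S
      ≤ 32 * r ^ 4 * ∫ x in Metric.closedBall p r, (‖dx h x‖ ^ 2 + ‖dy h x‖ ^ 2) := by
  have hd : Differentiable ℝ h := hh.differentiable (by simp)
  have hcx : Continuous (dx h) := (hh.continuous_fderiv (by simp)).clm_apply continuous_const
  have hcy : Continuous (dy h) := (hh.continuous_fderiv (by simp)).clm_apply continuous_const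
  set B := Metric.closedBall p r with hB
  have hBc : IsCompact B := isCompact_closedBall p r
  set I₁ := Icc (p.1 - r) (p.1 + r)
  set I₂ := Icc (p.2 - r) (p.2 + r)
  have hBI : B = I₁ ×ˢ I₂ := closedBall_plane p r
  have hI₁ : volume.real I₁ = 2 * r := by
    rw [Real.volume_real_Icc_of_le (by linarith)]; ring
  have hI₂ : volume.real I₂ = 2 * r := by
    rw [Real.volume_real_Icc_of_le (by linarith)]; ring
  have hvB : volume.real B = 4 * r ^ 2 := by
    rw [hBI, Measure.volume_eq_prod, measureReal_prod_prod, hI₁, hI₂]; ring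
  set α : ℝ → ℝ := fun y => ∫ s in I₁, ‖dx h (s, y)‖ ^ 2
  set β : ℝ → ℝ := fun x => ∫ s in I₂, ‖dy h (x, s)‖ ^ 2
  have hα : Continuous α := continuous_parametric_integral_of_continuous
    (f := fun y s => ‖dx h (s, y)‖ ^ 2) (by fun_prop) isCompact_Icc
  have hβ : Continuous β := continuous_parametric_integral_of_continuous
    (f := fun x s => ‖dy h (x, s)‖ ^ 2) (by fun_prop) isCompact_Icc
  have hα0 : ∀ y, 0 ≤ α y := fun y => integral_nonneg fun s => by positivity
  have hβ0 : ∀ y, 0 ≤ β y := fun y => integral_nonneg fun s => by positivity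
  have ix : IntegrableOn (fun x : ℝ × ℝ => ‖dx h x‖ ^ 2) B :=
    (hcx.norm.pow 2).continuousOn.integrableOn_compact hBc
  have iy : IntegrableOn (fun x : ℝ × ℝ => ‖dy h x‖ ^ 2) B :=
    (hcy.norm.pow 2).continuousOn.integrableOn_compact hBc
  have hres : (volume : Measure (ℝ × ℝ)).restrict B
      = (volume.restrict I₁).prod (volume.restrict I₂) := by
    rw [hBI, Measure.volume_eq_prod, Measure.prod_restrict]
  have hαB : ∫ x in B, α x.2 = 2 * r * ∫ x in B, ‖dx h x‖ ^ 2 := by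
    rw [IntegrableOn, hres] at ix
    rw [hres, integral_prod_symm _ ix, integral_fun_snd]
    simp [hI₁, α]
  have hβB : ∫ x in B, β x.1 = 2 * r * ∫ x in B, ‖dy h x‖ ^ 2 := by
    rw [IntegrableOn, hres] at iy
    rw [hres, integral_prod _ iy, integral_fun_fst]
    simp [hI₂, β]
  have key : ∀ x ∈ T, ∀ y ∈ S, (b - a) ^ 2 ≤ 4 * r * α x.2 + 4 * r * β y.1 := by
    intro x hx y hy
    have hxB := hTB hx
    have hyB := hSB hy
    rw [hBI] at hxB hyB
    have h1 := sq_norm_sub_le (φ := fun t => h (t, x.2)) (φ' := fun t => dx h (t, x.2))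
      hxB.1 hyB.1 (fun t => hasDerivAt_dx hd t x.2) (by fun_prop)
    have h2 := sq_norm_sub_le (φ := fun t => h (y.1, t)) (φ' := fun t => dy h (y.1, t))
      hxB.2 hyB.2 (fun t => hasDerivAt_dy hd y.1 t) (by fun_prop)
    have e1 : (p.1 + r - (p.1 - r)) = 2 * r := by ring
    have e2 : (p.2 + r - (p.2 - r)) = 2 * r := by ring
    rw [e1] at h1
    rw [e2] at h2
    change _ ≤ 2 * r * α x.2 at h1
    change _ ≤ 2 * r * β y.1 at h2
    simp only [Real.norm_eq_abs, sq_abs] at h1 h2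
    have h3 := ha y hy
    have h4 := hb x hx
    have h5 : (b - a) ^ 2 ≤ (h x - h y) ^ 2 := by
      apply pow_le_pow_left₀ <;> linarith
    have h6 : (h x - h y) ^ 2
        ≤ 2 * (h (x.1, x.2) - h (y.1, x.2)) ^ 2 + 2 * (h (y.1, x.2) - h (y.1, y.2)) ^ 2 := by
      change (h (x.1, x.2) - h (y.1, y.2)) ^ 2 ≤ _
      nlinarith [sq_nonneg ((h (x.1, x.2) - h (y.1, x.2)) - (h (y.1, x.2) - h (y.1, y.2)))]
    linarith
  have hTf : volume T ≠ ⊤ := ((measure_mono hTB).trans_lt hBc.measure_lt_top).ne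
  have hSf : volume S ≠ ⊤ := ((measure_mono hSB).trans_lt hBc.measure_lt_top).ne
  have iα : IntegrableOn (fun x : ℝ × ℝ => α x.2) B :=
    (hα.comp continuous_snd).continuousOn.integrableOn_compact hBc
  have iβ : IntegrableOn (fun x : ℝ × ℝ => β x.1) B :=
    (hβ.comp continuous_fst).continuousOn.integrableOn_compact hBc
  have hvT : volume.real T ≤ 4 * r ^ 2 := hvB ▸ measureReal_mono hTB hBc.measure_lt_top.ne
  have hvS : volume.real S ≤ 4 * r ^ 2 := hvB ▸ measureReal_mono hSB hBc.measure_lt_top.ne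
  set Dx := ∫ x in B, ‖dx h x‖ ^ 2
  set Dy := ∫ x in B, ‖dy h x‖ ^ 2
  have hDx : 0 ≤ Dx := integral_nonneg fun x => by positivity
  have hDy : 0 ≤ Dy := integral_nonneg fun x => by positivity
  have step1 : ∀ y ∈ S, (b - a) ^ 2 * volume.real T
      ≤ 8 * r ^ 2 * Dx + 4 * r * volume.real T * β y.1 := by
    intro y hy
    have h1 := setIntegral_ge_of_const_le_real (μ := volume)
      (f := fun x : ℝ × ℝ => 4 * r * α x.2 + 4 * r * β y.1) hT hTf
      (c := (b - a) ^ 2) (fun x hx => key x hx y hy)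
      (((iα.mono_set hTB).const_mul _).add (integrableOn_const hTf))
    rw [integral_add ((iα.mono_set hTB).const_mul _) (integrableOn_const hTf),
      integral_const_mul, setIntegral_const, smul_eq_mul] at h1
    have h2 : ∫ x in T, α x.2 ≤ ∫ x in B, α x.2 :=
      setIntegral_mono_set iα (Eventually.of_forall fun x => hα0 _) hTB.eventuallyLE
    rw [hαB] at h2
    nlinarith
  have step2 := setIntegral_ge_of_const_le_real (μ := volume)
      (f := fun y : ℝ × ℝ => 8 * r ^ 2 * Dx + 4 * r * volume.real T * β y.1) hS hSf
      (c := (b - a) ^ 2 * volume.real T) step1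
      ((integrableOn_const hSf).add ((iβ.mono_set hSB).const_mul _))
  have iS : Integrable (fun _ : ℝ × ℝ => 8 * r ^ 2 * Dx) (volume.restrict S) :=
    integrableOn_const hSf
  rw [integral_add iS ((iβ.mono_set hSB).const_mul _),
      setIntegral_const, smul_eq_mul, integral_const_mul (4 * r * volume.real T)] at step2
  have h2 : ∫ x in S, β x.1 ≤ ∫ x in B, β x.1 :=
      setIntegral_mono_set iβ (Eventually.of_forall fun x => hβ0 _) hSB.eventuallyLE
  rw [hβB] at h2
  rw [integral_add ix iy]
  have h3 : 4 * r * volume.real T * ∫ x in S, β x.1 ≤ 4 * r * volume.real T * (2 * r * Dy) := by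
    gcongr
  have h4 : volume.real S * (8 * r ^ 2 * Dx) ≤ 4 * r ^ 2 * (8 * r ^ 2 * Dx) := by gcongr
  have h5 : volume.real T * (8 * r ^ 2 * Dy) ≤ 4 * r ^ 2 * (8 * r ^ 2 * Dy) := by gcongr
  linarith

section
variable {ω : Set (ℝ × ℝ)}

lemma PlaneTest.of_zero {F₁ F₂ F₃ : Type*} [NormedAddCommGroup F₁] [NormedSpace ℝ F₁]
    [NormedAddCommGroup F₂] [NormedSpace ℝ F₂] [NormedAddCommGroup F₃] [NormedSpace ℝ F₃]
    {f : ℝ × ℝ → F₁} {g : ℝ × ℝ → F₂} {h : ℝ × ℝ → F₃}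
    (hf : PlaneTest ω f) (hg : PlaneTest ω g) (hh : ContDiff ℝ (⊤ : ℕ∞) h)
    (h0 : ∀ p, f p = 0 → g p = 0 → h p = 0) : PlaneTest ω h := by
  have hs : tsupport h ⊆ tsupport f ∪ tsupport g := by
    refine closure_minimal (fun p hp => ?_)
      ((isClosed_tsupport f).union (isClosed_tsupport g))
    by_contra hn
    rw [mem_union, not_or] at hn
    exact hp (h0 p (image_eq_zero_of_notMem_tsupport hn.1) (image_eq_zero_of_notMem_tsupport hn.2))
  exact ⟨hh, (hf.compact.isCompact.union hg.compact.isCompact).of_isClosed_subset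
    (isClosed_tsupport h) hs, hs.trans (union_subset hf.supp hg.supp)⟩

lemma PlaneTest.add_mul_sq_div {g η : ℝ × ℝ → ℝ} (hg : PlaneTest ω g) (hη : PlaneTest ω η)
    (g0 : ∀ p, 0 ≤ g p) {δ : ℝ} (hδ : 0 < δ) (t : ℝ) :
    PlaneTest ω (fun p => g p + t * (η p ^ 2 / (g p + δ))) := by
  refine hg.of_zero hη (hg.smooth.add (contDiff_const.mul ((hη.smooth.pow 2).div
      (hg.smooth.add contDiff_const) fun p => ?_))) fun p h1 h2 => by simp [h1, h2]
  have := g0 p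
  positivity

lemma dx_add_mul_sq_div {g η : ℝ × ℝ → ℝ} (hg : Differentiable ℝ g) (hη : Differentiable ℝ η)
    (g0 : ∀ p, 0 ≤ g p) {δ : ℝ} (hδ : 0 < δ) (t : ℝ) (p v : ℝ × ℝ) :
    fderiv ℝ (fun p => g p + t * (η p ^ 2 / (g p + δ))) p v
      = fderiv ℝ g p v + t * (2 * η p * fderiv ℝ η p v / (g p + δ)
        - η p ^ 2 * fderiv ℝ g p v / (g p + δ) ^ 2) := by
  have hne : g p + δ ≠ 0 := by have := g0 p; positivity
  have hlin : HasDerivAt (fun s : ℝ => p + s • v) v 0 := by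
    simpa using ((hasDerivAt_id (0 : ℝ)).smul_const v).const_add p
  have key : ∀ {f : ℝ × ℝ → ℝ}, DifferentiableAt ℝ f p →
      HasDerivAt (fun s : ℝ => f (p + s • v)) (fderiv ℝ f p v) 0 := by
    intro f hf
    have h0 : p = p + (0 : ℝ) • v := by simp
    have := hf.hasFDerivAt
    rw [h0] at this
    have := this.comp_hasDerivAt (0 : ℝ) hlin
    simpa [Function.comp_def] using this
  have hF : DifferentiableAt ℝ (fun p => g p + t * (η p ^ 2 / (g p + δ))) p := by
    fun_prop (disch := exact hne)
  refine (key hF).unique ?_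
  have h1 := key (hg p)
  have h2 := key (hη p)
  have h3 := h1.add (((h2.pow 2).div (h1.add_const δ) (by simpa using hne)).const_mul t)
  refine h3.congr_deriv ?_
  simp only [Pi.pow_apply, zero_smul, add_zero]
  field_simp
  push_cast
  ring

lemma tested_pointwise {a b e G t δ : ℝ} (hδ : 0 < δ) (ht : 0 < t) (hG : 0 ≤ G)
    (he : |e| ≤ 1) :
    (a + t * (2 * e * b / (G + δ) - e ^ 2 * a / (G + δ) ^ 2)) ^ 2
      ≤ a ^ 2 + 4 * t * b ^ 2 - t * (e ^ 2 * (a / (G + δ)) ^ 2)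
        + t ^ 2 * (8 / δ ^ 2 * b ^ 2 + 2 / δ ^ 4 * a ^ 2) := by
  have hGδ : 0 < G + δ := by positivity
  set L := a / (G + δ) with hL
  have haL : a = L * (G + δ) := by rw [hL]; field_simp
  have he2 : e ^ 2 ≤ 1 := by rw [← sq_abs]; exact pow_le_one₀ (abs_nonneg _) he
  have e1 : 2 * e * b / (G + δ) - e ^ 2 * a / (G + δ) ^ 2
      = 2 * e * (b / (G + δ)) - e ^ 2 * (L / (G + δ)) := by
    rw [haL]; field_simp
  set ψ := 2 * e * b / (G + δ) - e ^ 2 * a / (G + δ) ^ 2 with hψ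
  have h1 : a * ψ ≤ 2 * b ^ 2 - e ^ 2 * L ^ 2 / 2 := by
    have : a * ψ = 2 * e * b * L - e ^ 2 * L ^ 2 := by
      rw [hψ, haL]; field_simp
    rw [this]
    nlinarith [sq_nonneg (2 * b - e * L)]
  have h2 : ψ ^ 2 ≤ 8 / δ ^ 2 * b ^ 2 + 2 / δ ^ 4 * a ^ 2 := by
    have hb : (b / (G + δ)) ^ 2 ≤ b ^ 2 / δ ^ 2 := by
      rw [div_pow]; gcongr; linarith
    have hl : (L / (G + δ)) ^ 2 ≤ a ^ 2 / δ ^ 4 := by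
      have : (L / (G + δ)) ^ 2 = a ^ 2 / (G + δ) ^ 4 := by rw [hL]; field_simp
      rw [this]; gcongr; linarith
    have h3 : ψ ^ 2 ≤ 2 * (2 * e * (b / (G + δ))) ^ 2 + 2 * (e ^ 2 * (L / (G + δ))) ^ 2 := by
      rw [e1]
      nlinarith [sq_nonneg (2 * e * (b / (G + δ)) + e ^ 2 * (L / (G + δ)))]
    have h4 : e ^ 2 * (b / (G + δ)) ^ 2 ≤ 1 * (b ^ 2 / δ ^ 2) := by gcongr
    have h5 : (e ^ 2) ^ 2 * (L / (G + δ)) ^ 2 ≤ 1 * (a ^ 2 / δ ^ 4) := by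
      gcongr
      exact pow_le_one₀ (sq_nonneg e) he2
    calc _ ≤ _ := h3
      _ = 8 * (e ^ 2 * (b / (G + δ)) ^ 2) + 2 * ((e ^ 2) ^ 2 * (L / (G + δ)) ^ 2) := by ring
      _ ≤ 8 * (1 * (b ^ 2 / δ ^ 2)) + 2 * (1 * (a ^ 2 / δ ^ 4)) := by gcongr
      _ = _ := by ring
  have h3 : t * (a * ψ) ≤ t * (2 * b ^ 2 - e ^ 2 * L ^ 2 / 2) := by gcongr
  have h4 : t ^ 2 * ψ ^ 2 ≤ t ^ 2 * (8 / δ ^ 2 * b ^ 2 + 2 / δ ^ 4 * a ^ 2) := by gcongr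
  nlinarith

lemma integral_lincomb {X : Type*} [MeasurableSpace X] {μ : Measure X} {u v w : X → ℝ}
    (hu : Integrable u μ) (hv : Integrable v μ) (hw : Integrable w μ) (a b c d e : ℝ) :
    ∫ x, (u x + a * v x - b * w x + c * (d * v x + e * u x)) ∂μ
      = ∫ x, u x ∂μ + a * ∫ x, v x ∂μ - b * ∫ x, w x ∂μ
        + c * (d * ∫ x, v x ∂μ + e * ∫ x, u x ∂μ) := by
  have h : ∀ x, u x + a * v x - b * w x + c * (d * v x + e * u x)
      = (1 + c * e) * u x + ((a + c * d) * v x + (-b) * w x) := fun x => by ring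
  simp_rw [h]
  have h1 : Integrable (fun x => (a + c * d) * v x + (-b) * w x) μ :=
    (hv.const_mul _).add (hw.const_mul _)
  rw [integral_add (hu.const_mul _) h1, integral_add (hv.const_mul _) (hw.const_mul _),
    integral_const_mul, integral_const_mul, integral_const_mul]
  ring

lemma log_energy_le {g η : ℝ × ℝ → ℝ} (hg : PlaneTest ω g) (hη : PlaneTest ω η)
    (g0 : ∀ p, 0 ≤ g p) (η1 : ∀ p, |η p| ≤ 1) {δ t : ℝ} (hδ : 0 < δ) (ht : 0 < t) :
    t * ∫ p, (η p ^ 2 * ((dx g p / (g p + δ)) ^ 2 + (dy g p / (g p + δ)) ^ 2))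
      ≤ excess ω g + 4 * t * (∫ p, (‖dx η p‖ ^ 2 + ‖dy η p‖ ^ 2))
        + t ^ 2 * (8 / δ ^ 2 * (∫ p, (‖dx η p‖ ^ 2 + ‖dy η p‖ ^ 2))
          + 2 / δ ^ 4 * ∫ p, (‖dx g p‖ ^ 2 + ‖dy g p‖ ^ 2)) := by
  have hne : ∀ p, g p + δ ≠ 0 := fun p => by have := g0 p; positivity
  have hφ := hg.add_mul_sq_div hη g0 hδ t
  set φ := fun p => g p + t * (η p ^ 2 / (g p + δ)) with hφdef
  have h0 := excess_nonneg_real hφ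
  have iW : Integrable
      (fun p => η p ^ 2 * ((dx g p / (g p + δ)) ^ 2 + (dy g p / (g p + δ)) ^ 2)) := by
    refine Continuous.integrable_of_hasCompactSupport ?_ ?_
    · have := hg.continuous; have := hg.continuous_dx; have := hg.continuous_dy
      have := hη.continuous
      fun_prop (disch := exact hne _)
    · exact (hη.compact.comp_left (g := fun z => z ^ 2) (by simp)).mul_right
  have iη : Integrable (fun p => ‖dx η p‖ ^ 2 + ‖dy η p‖ ^ 2) :=
    hη.integrable_dx.add hη.integrable_dy
  have ig : Integrable (fun p => ‖dx g p‖ ^ 2 + ‖dy g p‖ ^ 2) :=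
    hg.integrable_dx.add hg.integrable_dy
  have hmono : ∫ p, (‖dx φ p‖ ^ 2 + ‖dy φ p‖ ^ 2) ≤ ∫ p, ((‖dx g p‖ ^ 2 + ‖dy g p‖ ^ 2)
      + 4 * t * (‖dx η p‖ ^ 2 + ‖dy η p‖ ^ 2)
      - t * (η p ^ 2 * ((dx g p / (g p + δ)) ^ 2 + (dy g p / (g p + δ)) ^ 2))
      + t ^ 2 * (8 / δ ^ 2 * (‖dx η p‖ ^ 2 + ‖dy η p‖ ^ 2)
        + 2 / δ ^ 4 * (‖dx g p‖ ^ 2 + ‖dy g p‖ ^ 2))) := by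
    refine integral_mono (hφ.integrable_dx.add hφ.integrable_dy) (((ig.add (iη.const_mul _)).sub
      (iW.const_mul _)).add (((iη.const_mul _).add (ig.const_mul _)).const_mul _)) fun p => ?_
    have ex : dx φ p = _ := dx_add_mul_sq_div hg.diff hη.diff g0 hδ t p (1, 0)
    have ey : dy φ p = _ := dx_add_mul_sq_div hg.diff hη.diff g0 hδ t p (0, 1)
    have bx := tested_pointwise (a := dx g p) (b := dx η p) hδ ht (g0 p) (η1 p)
    have hyy := tested_pointwise (a := dy g p) (b := dy η p) hδ ht (g0 p) (η1 p)
    simp only [Real.norm_eq_abs, sq_abs]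
    rw [ex, ey]
    change (dx g p + t * (2 * η p * dx η p / _ - η p ^ 2 * dx g p / _)) ^ 2
      + (dy g p + t * (2 * η p * dy η p / _ - η p ^ 2 * dy g p / _)) ^ 2 ≤ _
    linarith
  rw [integral_lincomb ig iη iW] at hmono
  have hm : ∫ p, ‖g p‖ ^ 2 ≤ ∫ p, ‖φ p‖ ^ 2 := by
    refine integral_mono hg.integrable hφ.integrable fun p => ?_
    have h1 := g0 p
    have h2 : 0 ≤ t * (η p ^ 2 / (g p + δ)) := by positivity
    have h3 : g p ≤ φ p := by simp only [hφdef]; linarith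
    simp only [Real.norm_eq_abs, sq_abs]
    gcongr
  have hE := mul_le_mul_of_nonneg_left hm (E1_nonneg ω)
  unfold excess at h0 ⊢
  linarith

end

section
variable {ω : Set (ℝ × ℝ)}

/-- Convergence to zero in measure of nonnegative functions on a set. -/
def VanishesOn (g : ℕ → ℝ × ℝ → ℝ) (S : Set (ℝ × ℝ)) : Prop :=
  ∀ t : ℝ, 0 < t → Tendsto (fun n => volume.real (S ∩ {p | t < g n p})) atTop (nhds 0)

/-- A normalized sequence of nonnegative test functions whose energy tends to the infimum. -/
structure MinSeq (ω : Set (ℝ × ℝ)) (g : ℕ → ℝ × ℝ → ℝ) : Prop where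
  test : ∀ n, PlaneTest ω (g n)
  nonneg : ∀ n p, 0 ≤ g n p
  norm_eq : ∀ n, ∫ p, ‖g n p‖ ^ 2 = 1
  excess_tendsto : Tendsto (fun n => excess ω (g n)) atTop (nhds 0)

lemma MinSeq.energy_eq {g : ℕ → ℝ × ℝ → ℝ} (hg : MinSeq ω g) (n : ℕ) :
    ∫ p, (‖dx (g n) p‖ ^ 2 + ‖dy (g n) p‖ ^ 2) = excess ω (g n) + E1 ω := by
  rw [excess, hg.norm_eq]; ring

lemma MinSeq.log_energy {g : ℕ → ℝ × ℝ → ℝ} (hg : MinSeq ω g) {η : ℝ × ℝ → ℝ}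
    (hη : PlaneTest ω η) (η1 : ∀ p, |η p| ≤ 1) {δ : ℝ} (hδ : 0 < δ) :
    ∀ᶠ n in atTop,
      ∫ p, (η p ^ 2 * ((dx (g n) p / (g n p + δ)) ^ 2 + (dy (g n) p / (g n p + δ)) ^ 2))
        ≤ 4 * (∫ p, (‖dx η p‖ ^ 2 + ‖dy η p‖ ^ 2)) + 2 := by
  set N := ∫ p, (‖dx η p‖ ^ 2 + ‖dy η p‖ ^ 2) with hN
  have hN0 : 0 ≤ N := integral_nonneg fun p => by positivity
  have hE := E1_nonneg ω
  set K := 8 / δ ^ 2 * N + 2 / δ ^ 4 * (1 + E1 ω) + 1 with hK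
  have hK0 : 0 < K := by positivity
  have ht : 0 < 1 / K := by positivity
  filter_upwards [hg.excess_tendsto.eventually_lt_const ht,
    hg.excess_tendsto.eventually_lt_const one_pos] with n h1 h2
  have h := log_energy_le (hg.test n) hη (hg.nonneg n) η1 hδ ht
  rw [hg.energy_eq, ← hN] at h
  have h3 : 8 / δ ^ 2 * N + 2 / δ ^ 4 * (excess ω (g n) + E1 ω) ≤ K := by
    have : 2 / δ ^ 4 * (excess ω (g n) + E1 ω) ≤ 2 / δ ^ 4 * (1 + E1 ω) := by gcongr
    linarith
  have h4 : (1 / K) ^ 2 * (8 / δ ^ 2 * N + 2 / δ ^ 4 * (excess ω (g n) + E1 ω)) ≤ 1 / K := by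
    calc _ ≤ (1 / K) ^ 2 * K := by gcongr
      _ = 1 / K := by field_simp
  refine le_of_mul_le_mul_left ?_ ht
  linarith

lemma MinSeq.vanishesOn_closedBall {g : ℕ → ℝ × ℝ → ℝ} (hg : MinSeq ω g) {p : ℝ × ℝ} {r : ℝ}
    (hr : 0 < r) (hp : Metric.closedBall p (2 * r) ⊆ ω) {S : Set (ℝ × ℝ)} (hS : MeasurableSet S)
    (hSB : S ⊆ Metric.closedBall p r) (hS0 : 0 < volume.real S) (hv : VanishesOn g S) :
    VanishesOn g (Metric.closedBall p r) := by
  let bump : ContDiffBump p := ⟨r, 2 * r, hr, by linarith⟩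
  have hη : PlaneTest ω (bump : ℝ × ℝ → ℝ) :=
    ⟨bump.contDiff, bump.hasCompactSupport, by rw [bump.tsupport_eq]; exact hp⟩
  have η1 : ∀ x, |bump x| ≤ 1 := fun x => by
    rw [abs_of_nonneg bump.nonneg]; exact bump.le_one
  set C := 4 * (∫ x, (‖dx bump x‖ ^ 2 + ‖dy bump x‖ ^ 2)) + 2 with hC
  have hC0 : 0 < C := by
    have : 0 ≤ ∫ x, (‖dx bump x‖ ^ 2 + ‖dy bump x‖ ^ 2) := integral_nonneg fun p => by positivity
    positivity
  intro t ht
  refine (tendsto_order.2 ⟨fun a ha => Eventually.of_forall fun n =>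
    ha.trans_le measureReal_nonneg, fun ε hε => ?_⟩)
  set σ := volume.real S
  set M := 64 * r ^ 4 * C / (σ * ε) + 1 with hM
  have hM1 : 1 ≤ M := by
    have : 0 ≤ 64 * r ^ 4 * C / (σ * ε) := by positivity
    linarith
  set δ := t * Real.exp (-(M + Real.log 2)) with hδ
  have hδ0 : 0 < δ := by positivity
  have hB : MeasurableSet (Metric.closedBall p r) := Metric.isClosed_closedBall.measurableSet
  have hBf : volume (Metric.closedBall p r) ≠ ⊤ := (isCompact_closedBall p r).measure_lt_top.ne
  filter_upwards [hg.log_energy hη η1 hδ0, (hv δ hδ0).eventually_lt_const (half_pos hS0)]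
    with n h1 h2
  have gc := (hg.test n).continuous
  have g0 := hg.nonneg n
  have hmeas : ∀ s : ℝ, MeasurableSet {x | s < g n x} := fun s =>
    (isOpen_lt continuous_const gc).measurableSet
  set S' := S \ {x | δ < g n x} with hS'
  set T := Metric.closedBall p r ∩ {x | t < g n x} with hT
  have hσ : σ / 2 ≤ volume.real S' := by
    have h3 : volume.real (S ∩ {x | δ < g n x}) + volume.real S' = σ :=
      measureReal_inter_add_sdiff (s := S) (hmeas δ) (measure_ne_top_of_subset hSB hBf)
    linarith
  have hne : ∀ x, g n x + δ ≠ 0 := fun x => by have := g0 x; positivity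
  set h : ℝ × ℝ → ℝ := fun x => Real.log (g n x + δ) with hh
  have hsm : ContDiff ℝ (⊤ : ℕ∞) h := ((hg.test n).smooth.add contDiff_const).log hne
  have hder : ∀ x v, fderiv ℝ h x v = fderiv ℝ (g n) x v / (g n x + δ) := by
    intro x v
    have := (((hg.test n).diff x).hasFDerivAt.add_const δ).log (hne x)
    rw [this.fderiv]
    simp [div_eq_inv_mul]
  have key := sq_sub_mul_measure_le hsm hr (hS.diff (hmeas δ)) (hB.inter (hmeas t))
    (sdiff_subset.trans hSB) inter_subset_left
    (a := Real.log (2 * δ)) (b := Real.log t) ?_ ?_ ?_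
  · have e1 : Real.log t - Real.log (2 * δ) = M := by
      rw [hδ, Real.log_mul (by norm_num) (by positivity), Real.log_mul ht.ne' (by positivity),
        Real.log_exp]
      ring
    rw [e1] at key
    have h3 : ∫ x in Metric.closedBall p r, (‖dx h x‖ ^ 2 + ‖dy h x‖ ^ 2) ≤ C := by
      refine le_trans ?_ h1
      have hcx := (hg.test n).continuous_dx
      have hcy := (hg.test n).continuous_dy
      have e2 : ∫ x in Metric.closedBall p r, (‖dx h x‖ ^ 2 + ‖dy h x‖ ^ 2)
          = ∫ x in Metric.closedBall p r, (bump x ^ 2 *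
            ((dx (g n) x / (g n x + δ)) ^ 2 + (dy (g n) x / (g n x + δ)) ^ 2)) := by
        refine setIntegral_congr_fun hB fun x hx => ?_
        have : bump x = 1 := bump.one_of_mem_closedBall hx
        simp only [this, Real.norm_eq_abs, sq_abs, dx, dy, hder]
        ring
      rw [e2]
      refine setIntegral_le_integral ?_ (Eventually.of_forall fun x => by positivity)
      refine Continuous.integrable_of_hasCompactSupport ?_ ?_
      · have := hη.continuous
        fun_prop (disch := exact hne _)
      · exact (hη.compact.comp_left (g := fun z => z ^ 2) (by simp)).mul_right
    have hMsq : M ≤ M ^ 2 := by nlinarith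
    have hT0 : 0 ≤ volume.real T := measureReal_nonneg
    have h5 : M * volume.real T * (σ / 2) ≤ 32 * r ^ 4 * C := by
      calc M * volume.real T * (σ / 2) ≤ M ^ 2 * volume.real T * volume.real S' := by gcongr
        _ ≤ _ := key
        _ ≤ _ := by gcongr
    by_contra! hcon
    have h6 : M * ε * (σ / 2) ≤ 32 * r ^ 4 * C := le_trans (by gcongr) h5
    have h7 : M * ε * (σ / 2) = 32 * r ^ 4 * C + ε * σ / 2 := by
      rw [hM]; field_simp; ring
    have : 0 < ε * σ / 2 := by positivity
    linarith
  · refine Real.log_le_log (by positivity) ?_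
    have : Real.exp (-(M + Real.log 2)) ≤ 1 / 2 := by
      rw [Real.exp_neg, Real.exp_add, Real.exp_log (by norm_num)]
      rw [inv_le_comm₀ (by positivity) (by norm_num)]
      have : 1 ≤ Real.exp M := Real.one_le_exp (by linarith)
      norm_num
      linarith
    nlinarith
  · rintro x ⟨-, hx⟩
    simp only [mem_ofPred_eq, not_lt] at hx
    have := g0 x
    exact Real.log_le_log (by positivity) (by linarith)
  · rintro x ⟨-, hx⟩
    exact Real.log_le_log ht (by have : t < g n x := hx; linarith)

lemma VanishesOn.mono {g : ℕ → ℝ × ℝ → ℝ} {S T : Set (ℝ × ℝ)} (h : VanishesOn g T)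
    (hST : S ⊆ T) (hT : volume T ≠ ⊤) : VanishesOn g S := fun t ht =>
  squeeze_zero (fun _ => measureReal_nonneg) (fun _ => measureReal_mono
    (inter_subset_inter_left _ hST) (measure_ne_top_of_subset inter_subset_left hT)) (h t ht)

lemma MinSeq.vanishes_nhds {g : ℕ → ℝ × ℝ → ℝ} (hg : MinSeq ω g) (hω : IsOpen ω)
    (hc : IsConnected ω) {A : Set (ℝ × ℝ)} (hA : MeasurableSet A) (hAω : A ⊆ ω)
    (hA0 : volume A ≠ 0) (hAf : volume A ≠ ⊤) (hAv : VanishesOn g A) :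
    ∀ p ∈ ω, ∃ r > 0, VanishesOn g (Metric.ball p r) := by
  set U := {p | ∃ r > 0, VanishesOn g (Metric.ball p r)} with hU
  have hball : ∀ (p : ℝ × ℝ) (r : ℝ), volume (Metric.ball p r) ≠ ⊤ := fun p r =>
    measure_ball_lt_top.ne
  have room : ∀ p ∈ ω, ∃ r > 0, Metric.closedBall p (2 * r) ⊆ ω := by
    intro p hp
    obtain ⟨ε, hε, h⟩ := Metric.isOpen_iff.1 hω p hp
    exact ⟨ε / 4, by positivity, (Metric.closedBall_subset_ball (by linarith)).trans h⟩
  have hUo : IsOpen U := by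
    rw [Metric.isOpen_iff]
    rintro p ⟨r, hr, h⟩
    refine ⟨r / 2, by positivity, fun q hq => ⟨r / 2, by positivity, h.mono ?_ (hball p r)⟩⟩
    intro x hx
    rw [Metric.mem_ball] at *
    linarith [dist_triangle x q p]
  have h1 : (ω ∩ U).Nonempty := by
    obtain ⟨p, hpA, hp⟩ := exists_mem_forall_mem_nhdsWithin_pos_measure hA0
    obtain ⟨r, hr, h⟩ := room p (hAω hpA)
    refine ⟨p, hAω hpA, r, hr, ?_⟩
    have hS := hp (Metric.closedBall p r ∩ A)
      (inter_comm A _ ▸ inter_mem_nhdsWithin A (Metric.closedBall_mem_nhds p hr))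
    have hBf : volume (Metric.closedBall p r) ≠ ⊤ := (isCompact_closedBall p r).measure_lt_top.ne
    have := hg.vanishesOn_closedBall hr h
      (Metric.isClosed_closedBall.measurableSet.inter hA) inter_subset_left
      (ENNReal.toReal_pos hS.ne' (measure_ne_top_of_subset inter_subset_left hBf))
      (hAv.mono inter_subset_right hAf)
    exact this.mono Metric.ball_subset_closedBall hBf
  have h2 : closure U ∩ ω ⊆ U := by
    rintro p ⟨hpU, hpω⟩
    obtain ⟨r, hr, h⟩ := room p hpω
    obtain ⟨q, hqB, ⟨r', hr', hq⟩⟩ := mem_closure_iff.1 hpU _ Metric.isOpen_ball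
      (Metric.mem_ball_self hr)
    have hBf : volume (Metric.closedBall p r) ≠ ⊤ := (isCompact_closedBall p r).measure_lt_top.ne
    have hO : IsOpen (Metric.ball p r ∩ Metric.ball q r') :=
      Metric.isOpen_ball.inter Metric.isOpen_ball
    have hpos := hO.measure_pos volume ⟨q, hqB, Metric.mem_ball_self hr'⟩
    refine ⟨r, hr, (hg.vanishesOn_closedBall hr h hO.measurableSet
      (inter_subset_left.trans Metric.ball_subset_closedBall)
      (ENNReal.toReal_pos hpos.ne' (measure_ne_top_of_subset inter_subset_left (hball p r)))
      (hq.mono inter_subset_right (hball q r'))).mono Metric.ball_subset_closedBall hBf⟩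
  exact hc.isPreconnected.subset_of_closure_inter_subset hUo h1 h2

end

section
variable {ω : Set (ℝ × ℝ)}

lemma abs_le_integral_deriv {u u' : ℝ → ℝ} (hu : ∀ t, HasDerivAt u (u' t) t)
    (hc : Continuous u') (hs : HasCompactSupport u) (x : ℝ) :
    u x ≤ ∫ t, |u' t| := by
  have hd : deriv u = u' := funext fun t => (hu t).deriv
  have hs' : HasCompactSupport u' := hd ▸ hs.deriv
  have hi : Integrable u' := hc.integrable_of_hasCompactSupport hs'
  have h1 : ∫ t in Iic x, u' t = u x := by
    rw [← hd]
    exact HasCompactSupport.integral_Iic_deriv_eq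
      (contDiff_one_iff_deriv.2 ⟨fun t => (hu t).differentiableAt, hd ▸ hc⟩) hs x
  rw [← h1]
  calc _ ≤ ∫ t in Iic x, |u' t| :=
        integral_mono hi.integrableOn hi.abs.integrableOn fun t => le_abs_self _
    _ ≤ _ := setIntegral_le_integral hi.abs (Eventually.of_forall fun t => abs_nonneg _)

lemma isClosedEmbedding_pair_right {X Y : Type*} [TopologicalSpace X] [TopologicalSpace Y]
    [T1Space Y] (y : Y) : Topology.IsClosedEmbedding (fun x : X => (x, y)) := by
  refine ⟨isEmbedding_prodMkLeft y, ?_⟩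
  have : range (fun x : X => (x, y)) = Prod.snd ⁻¹' {y} := by
    ext ⟨a, b⟩; simp [eq_comm]
  rw [this]
  exact isClosed_singleton.preimage continuous_snd

lemma isClosedEmbedding_pair_left {X Y : Type*} [TopologicalSpace X] [TopologicalSpace Y]
    [T1Space X] (x : X) : Topology.IsClosedEmbedding (fun y : Y => (x, y)) := by
  refine ⟨isEmbedding_prodMkRight x, ?_⟩
  have : range (fun y : Y => (x, y)) = Prod.fst ⁻¹' {x} := by
    ext ⟨a, b⟩; simp [eq_comm]
  rw [this]
  exact isClosed_singleton.preimage continuous_fst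

/-- A Ladyzhenskaya type inequality. -/
lemma PlaneTest.integral_pow_four_le {g : ℝ × ℝ → ℝ} (hg : PlaneTest ω g) :
    ∫ p, g p ^ 4 ≤ (∫ p, |2 * g p * dx g p|) * ∫ p, |2 * g p * dy g p| := by
  have hc := hg.continuous
  have hcx := hg.continuous_dx
  have hcy := hg.continuous_dy
  have ix : Integrable (fun p => |2 * g p * dx g p|) :=
    Continuous.integrable_of_hasCompactSupport (by fun_prop)
      ((hg.compact_dx.mul_left (f := fun p => 2 * g p)).abs)
  have iy : Integrable (fun p => |2 * g p * dy g p|) :=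
    Continuous.integrable_of_hasCompactSupport (by fun_prop)
      ((hg.compact_dy.mul_left (f := fun p => 2 * g p)).abs)
  have i4 : Integrable (fun p => g p ^ 4) :=
    Continuous.integrable_of_hasCompactSupport (by fun_prop)
      (hg.compact.comp_left (g := fun z => z ^ 4) (by simp))
  have hx : ∀ x y : ℝ, g (x, y) ^ 2 ≤ ∫ s, |2 * g (s, y) * dx g (s, y)| := by
    intro x y
    refine abs_le_integral_deriv (u := fun s => g (s, y) ^ 2)
      (u' := fun s => 2 * g (s, y) * dx g (s, y)) (fun t => ?_) (by fun_prop) ?_ x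
    · exact ((hasDerivAt_dx hg.diff t y).pow 2).congr_deriv (by simp)
    · exact (hg.compact.comp_isClosedEmbedding (isClosedEmbedding_pair_right y)).comp_left
        (g := fun z : ℝ => z ^ 2) (by simp)
  have hy : ∀ x y : ℝ, g (x, y) ^ 2 ≤ ∫ s, |2 * g (x, s) * dy g (x, s)| := by
    intro x y
    refine abs_le_integral_deriv (u := fun s => g (x, s) ^ 2)
      (u' := fun s => 2 * g (x, s) * dy g (x, s)) (fun t => ?_) (by fun_prop) ?_ y
    · exact ((hasDerivAt_dy hg.diff x t).pow 2).congr_deriv (by simp)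
    · exact (hg.compact.comp_isClosedEmbedding (isClosedEmbedding_pair_left x)).comp_left
        (g := fun z : ℝ => z ^ 2) (by simp)
  rw [Measure.volume_eq_prod] at ix iy
  have e : (∫ p, |2 * g p * dx g p|) * ∫ p, |2 * g p * dy g p|
      = ∫ p : ℝ × ℝ, (∫ s, |2 * g (p.1, s) * dy g (p.1, s)|)
          * ∫ s, |2 * g (s, p.2) * dx g (s, p.2)| := by
    rw [Measure.volume_eq_prod, integral_prod_symm _ ix, integral_prod _ iy, mul_comm]
    exact (integral_prod_mul (fun x => ∫ s, |2 * g (x, s) * dy g (x, s)|)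
      (fun y => ∫ s, |2 * g (s, y) * dx g (s, y)|)).symm
  rw [e]
  refine integral_mono i4 (iy.integral_prod_left.mul_prod ix.integral_prod_right) fun p => ?_
  have h1 := hx p.1 p.2
  have h2 := hy p.1 p.2
  calc g p ^ 4 = g (p.1, p.2) ^ 2 * g (p.1, p.2) ^ 2 := by ring
    _ ≤ _ := by gcongr

lemma PlaneTest.integral_pow_four_le_sq {g : ℝ × ℝ → ℝ} (hg : PlaneTest ω g) :
    ∫ p, g p ^ 4 ≤ ((∫ p, ‖g p‖ ^ 2) + ∫ p, (‖dx g p‖ ^ 2 + ‖dy g p‖ ^ 2)) ^ 2 := by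
  refine hg.integral_pow_four_le.trans ?_
  have id : Integrable (fun p => ‖dx g p‖ ^ 2 + ‖dy g p‖ ^ 2) :=
    hg.integrable_dx.add hg.integrable_dy
  have ig : Integrable (fun p => ‖g p‖ ^ 2 + (‖dx g p‖ ^ 2 + ‖dy g p‖ ^ 2)) :=
    hg.integrable.add id
  rw [← integral_add hg.integrable id, sq]
  have hx : ∫ p, |2 * g p * dx g p| ≤ ∫ p, (‖g p‖ ^ 2 + (‖dx g p‖ ^ 2 + ‖dy g p‖ ^ 2)) := by
    refine integral_mono_of_nonneg (Eventually.of_forall fun p => abs_nonneg _) ig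
      (Eventually.of_forall fun p => ?_)
    simp only [abs_mul, Real.norm_eq_abs, abs_two]
    nlinarith [sq_nonneg (|g p| - |dx g p|), sq_nonneg |dy g p|]
  have hy : ∫ p, |2 * g p * dy g p| ≤ ∫ p, (‖g p‖ ^ 2 + (‖dx g p‖ ^ 2 + ‖dy g p‖ ^ 2)) := by
    refine integral_mono_of_nonneg (Eventually.of_forall fun p => abs_nonneg _) ig
      (Eventually.of_forall fun p => ?_)
    simp only [abs_mul, Real.norm_eq_abs, abs_two]
    nlinarith [sq_nonneg (|g p| - |dy g p|), sq_nonneg |dx g p|]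
  exact mul_le_mul hx hy (integral_nonneg fun p => abs_nonneg _)
    (integral_nonneg fun p => by positivity)

lemma MinSeq.vanishesOn {g : ℕ → ℝ × ℝ → ℝ} (hg : MinSeq ω g) (hω : IsOpen ω)
    (hc : IsConnected ω) (hf : volume ω ≠ ⊤) {A : Set (ℝ × ℝ)} (hA : MeasurableSet A)
    (hAω : A ⊆ ω) (hA0 : volume A ≠ 0) (hAv : VanishesOn g A) : VanishesOn g ω := by
  have hloc := hg.vanishes_nhds hω hc hA hAω hA0 (measure_ne_top_of_subset hAω hf) hAv
  have hcomp : ∀ K, IsCompact K → K ⊆ ω → VanishesOn g (K ∩ ω) := by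
    intro K hK hKω
    refine hK.induction_on (p := fun S => VanishesOn g (S ∩ ω)) ?_ ?_ ?_ ?_
    · intro t _; simp
    · intro S T hST hT
      exact hT.mono (inter_subset_inter_left _ hST) (measure_ne_top_of_subset inter_subset_right hf)
    · intro S T hS hT t ht
      refine squeeze_zero (fun _ => measureReal_nonneg) (fun n => ?_)
        (by simpa using (hS t ht).add (hT t ht))
      rw [union_inter_distrib_right, union_inter_distrib_right]
      exact measureReal_union_le _ _
    · intro x hx
      obtain ⟨r, hr, h⟩ := hloc x (hKω hx)
      exact ⟨Metric.ball x r, mem_nhdsWithin_of_mem_nhds (Metric.ball_mem_nhds x hr),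
        h.mono inter_subset_left measure_ball_lt_top.ne⟩
  intro t ht
  refine (tendsto_order.2 ⟨fun a ha => Eventually.of_forall fun n =>
    ha.trans_le measureReal_nonneg, fun ε hε => ?_⟩)
  obtain ⟨K, hKω, hK, hlt⟩ := hω.measurableSet.exists_isCompact_sdiff_lt hf
    (ε := ENNReal.ofReal (ε / 2)) (by simpa using half_pos hε |>.not_ge)
  filter_upwards [(hcomp K hK hKω t ht).eventually_lt_const (half_pos hε)] with n hn
  have h1 : volume.real (ω \ K) < ε / 2 := by
    have := ENNReal.toReal_lt_of_lt_ofReal hlt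
    exact this
  have hfin : volume (K ∩ ω ∩ {p | t < g n p} ∪ ω \ K) ≠ ⊤ :=
    measure_ne_top_of_subset (union_subset
      (inter_subset_left.trans inter_subset_right) sdiff_subset) hf
  calc volume.real (ω ∩ {p | t < g n p})
      ≤ volume.real (K ∩ ω ∩ {p | t < g n p} ∪ ω \ K) := by
        refine measureReal_mono (fun x hx => ?_) hfin
        by_cases hxK : x ∈ K
        · exact Or.inl ⟨⟨hxK, hx.1⟩, hx.2⟩
        · exact Or.inr ⟨hx.1, hxK⟩
    _ ≤ volume.real (K ∩ ω ∩ {p | t < g n p}) + volume.real (ω \ K) := measureReal_union_le _ _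
    _ < ε := by linarith

lemma MinSeq.not_vanishesOn {g : ℕ → ℝ × ℝ → ℝ} (hg : MinSeq ω g) (hω : IsOpen ω)
    (hf : volume ω ≠ ⊤) : ¬ VanishesOn g ω := by
  intro hv
  have hE := E1_nonneg ω
  set V := volume.real ω
  have hV0 : 0 ≤ V := measureReal_nonneg
  set K := (2 + E1 ω) ^ 2 with hK
  have hK0 : 0 < K := by positivity
  set l := 1 / (4 * K) with hl
  have hl0 : 0 < l := by positivity
  set t := Real.sqrt (1 / (4 * (V + 1))) with ht
  have ht0 : 0 < t := Real.sqrt_pos.2 (by positivity)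
  have htsq : t ^ 2 = 1 / (4 * (V + 1)) := Real.sq_sqrt (by positivity)
  obtain ⟨n, h1, h2⟩ := ((hg.excess_tendsto.eventually_lt_const one_pos).and
    ((hv t ht0).eventually_lt_const (show 0 < l by positivity))).exists
  have ht' := hg.test n
  have gc := ht'.continuous
  have h4 := ht'.integral_pow_four_le_sq
  rw [hg.norm_eq, hg.energy_eq] at h4
  have h4' : ∫ p, g n p ^ 4 ≤ K := by
    refine h4.trans ?_
    have := excess_nonneg_real ht'
    exact pow_le_pow_left₀ (by linarith) (by linarith) 2
  set E := ω ∩ {p | t < g n p} with hEdef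
  have hEm : MeasurableSet E :=
    hω.measurableSet.inter (isOpen_lt continuous_const gc).measurableSet
  have hEf : volume E ≠ ⊤ := measure_ne_top_of_subset inter_subset_left hf
  have i4 : Integrable (fun p => g n p ^ 4) :=
    Continuous.integrable_of_hasCompactSupport (by fun_prop)
      (ht'.compact.comp_left (g := fun z => z ^ 4) (by simp))
  have iω : Integrable (ω.indicator fun _ => t ^ 2) :=
    (integrable_indicator_iff hω.measurableSet).2 (integrableOn_const hf)
  have iE : Integrable (E.indicator fun _ => 1 / (4 * l)) :=
    (integrable_indicator_iff hEm).2 (integrableOn_const hEf)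
  have iω4 : Integrable (fun p => ω.indicator (fun _ => t ^ 2) p + l * g n p ^ 4) :=
    iω.add (i4.const_mul l)
  have hle : ∫ p, ‖g n p‖ ^ 2 ≤ ∫ p, (ω.indicator (fun _ => t ^ 2) p + l * g n p ^ 4
      + E.indicator (fun _ => 1 / (4 * l)) p) := by
    refine integral_mono ht'.integrable (iω4.add iE) fun p => ?_
    simp only [Real.norm_eq_abs, sq_abs]
    by_cases hp : p ∈ ω
    · by_cases hpt : t < g n p
      · have hpE : p ∈ E := ⟨hp, hpt⟩
        simp only [indicator_of_mem hp, indicator_of_mem hpE]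
        have : g n p ^ 2 ≤ l * g n p ^ 4 + 1 / (4 * l) := by
          have : l * g n p ^ 4 + 1 / (4 * l) - g n p ^ 2 = l * (g n p ^ 2 - 1 / (2 * l)) ^ 2 := by
            field_simp; ring
          have h0 : 0 ≤ l * (g n p ^ 2 - 1 / (2 * l)) ^ 2 := by positivity
          linarith
        nlinarith
      · have hpE : p ∉ E := fun h => hpt h.2
        simp only [indicator_of_mem hp, indicator_of_notMem hpE]
        have h0 := hg.nonneg n p
        have : g n p ^ 2 ≤ t ^ 2 := by gcongr; exact not_lt.1 hpt
        have : 0 ≤ l * g n p ^ 4 := by positivity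
        linarith
    · have hpE : p ∉ E := fun h => hp h.1
      simp [indicator_of_notMem hp, indicator_of_notMem hpE, ht'.zero_of_notMem hp]
  rw [hg.norm_eq, integral_add iω4 iE, integral_add iω (i4.const_mul l),
    integral_const_mul, integral_indicator hω.measurableSet, integral_indicator hEm,
    setIntegral_const, setIntegral_const, smul_eq_mul, smul_eq_mul] at hle
  have e1 : V * t ^ 2 ≤ 1 / 4 := by
    rw [htsq, mul_one_div, div_le_div_iff₀ (by positivity) (by norm_num)]; linarith
  have e2 : l * ∫ p, g n p ^ 4 ≤ 1 / 4 := by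
    calc _ ≤ l * K := by gcongr
      _ = 1 / 4 := by rw [hl]; field_simp
  have e3 : volume.real E * (1 / (4 * l)) ≤ l * (1 / (4 * l)) := by gcongr
  have e4 : l * (1 / (4 * l)) = 1 / 4 := by field_simp
  linarith

end

section
variable {ω : Set (ℝ × ℝ)}

lemma dx_const_mul {g : ℝ × ℝ → ℝ} (hg : Differentiable ℝ g) (r : ℝ) (p : ℝ × ℝ) :
    dx (fun p => r * g p) p = r * dx g p := by
  simp [dx, fderiv_const_mul (hg p)]

lemma dy_const_mul {g : ℝ × ℝ → ℝ} (hg : Differentiable ℝ g) (r : ℝ) (p : ℝ × ℝ) :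
    dy (fun p => r * g p) p = r * dy g p := by
  simp [dy, fderiv_const_mul (hg p)]

lemma excess_const_mul {g : ℝ × ℝ → ℝ} (hg : Differentiable ℝ g) (r : ℝ) :
    excess ω (fun p => r * g p) = r ^ 2 * excess ω g := by
  simp only [excess, dx_const_mul hg, dy_const_mul hg, norm_mul, mul_pow, ← mul_add,
    integral_const_mul, Real.norm_eq_abs, sq_abs]
  ring

/-- Smallness on a set of positive measure costs a definite amount of energy. -/
lemma exists_coercive_nonneg (hω : IsOpen ω) (hc : IsConnected ω) (hf : volume ω ≠ ⊤)
    {A : Set (ℝ × ℝ)} (hA : MeasurableSet A) (hAω : A ⊆ ω) (hA0 : volume A ≠ 0) :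
    ∃ c > 0, ∀ g : ℝ × ℝ → ℝ, PlaneTest ω g → (∀ p, 0 ≤ g p) →
      c * ∫ p, ‖g p‖ ^ 2 ≤ excess ω g + ∫ p in A, ‖g p‖ ^ 2 := by
  by_contra! hcon
  choose g gt g0 glt using fun n : ℕ => hcon (1 / ((n : ℝ) + 1)) (by positivity)
  have hA' : ∀ n, 0 ≤ ∫ p in A, ‖g n p‖ ^ 2 := fun n => integral_nonneg fun p => by positivity
  have hI : ∀ n, 0 < ∫ p, ‖g n p‖ ^ 2 := by
    intro n
    have h1 := (add_nonneg (excess_nonneg_real (gt n)) (hA' n)).trans_lt (glt n)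
    exact pos_of_mul_pos_right h1 (by positivity)
  set r : ℕ → ℝ := fun n => (Real.sqrt (∫ p, ‖g n p‖ ^ 2))⁻¹ with hr
  have hr2 : ∀ n, r n ^ 2 = (∫ p, ‖g n p‖ ^ 2)⁻¹ := fun n => by
    simp only [hr, inv_pow]; rw [Real.sq_sqrt (hI n).le]
  have hr0 : ∀ n, 0 ≤ r n := fun n => by positivity
  have hnorm : ∀ n p, ‖r n * g n p‖ ^ 2 = r n ^ 2 * ‖g n p‖ ^ 2 := fun n p => by
    rw [norm_mul, mul_pow, Real.norm_eq_abs, sq_abs]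
  have small : ∀ n, excess ω (fun p => r n * g n p) + ∫ p in A, ‖r n * g n p‖ ^ 2
      ≤ 1 / ((n : ℝ) + 1) := by
    intro n
    simp only [hnorm, excess_const_mul (gt n).diff, integral_const_mul]
    rw [← mul_add, hr2, inv_mul_le_iff₀ (hI n), mul_comm]
    exact (glt n).le
  have ht : ∀ n, PlaneTest ω (fun p => r n * g n p) := fun n =>
    ⟨contDiff_const.mul (gt n).smooth, (gt n).compact.mul_left (f := fun _ => r n),
      (closure_mono (Function.support_mul_subset_right _ _)).trans (gt n).supp⟩
  have hex := fun n => excess_nonneg_real (ht n)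
  have hAr : ∀ n, 0 ≤ ∫ p in A, ‖r n * g n p‖ ^ 2 := fun n =>
    integral_nonneg fun p => by positivity
  have hseq : MinSeq ω (fun n p => r n * g n p) := by
    refine ⟨ht, fun n p => mul_nonneg (hr0 n) (g0 n p), fun n => ?_, ?_⟩
    · simp only [hnorm, integral_const_mul]
      rw [hr2, inv_mul_cancel₀ (hI n).ne']
    · exact squeeze_zero hex (fun n => by linarith [small n, hAr n])
        tendsto_one_div_add_atTop_nhds_zero_nat
  refine hseq.not_vanishesOn hω hf (hseq.vanishesOn hω hc hf hA hAω hA0 fun t ht0 => ?_)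
  have hlim : Tendsto (fun n : ℕ => (t ^ 2)⁻¹ * (1 / ((n : ℝ) + 1))) atTop (nhds 0) := by
    simpa using tendsto_one_div_add_atTop_nhds_zero_nat.const_mul ((t ^ 2)⁻¹)
  refine squeeze_zero (fun _ => measureReal_nonneg) (fun n => ?_) hlim
  have hcheb := mul_meas_ge_le_integral_of_nonneg (μ := volume.restrict A)
    (f := fun p => ‖r n * g n p‖ ^ 2) (Eventually.of_forall fun p => by positivity)
    (ht n).integrable.integrableOn (t ^ 2)
  rw [← div_eq_inv_mul, le_div_iff₀ (by positivity), mul_comm]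
  refine le_trans ?_ (hcheb.trans (by linarith [small n, hex n]))
  have hAf : volume A ≠ ⊤ := measure_ne_top_of_subset hAω hf
  gcongr
  rw [measureReal_def, measureReal_def]
  refine ENNReal.toReal_mono ?_ ?_
  · exact measure_ne_top_of_subset (subset_univ _) (by simpa using hAf)
  · rw [inter_comm, ← Measure.restrict_apply' hA]
    refine measure_mono fun p hp => ?_
    simp only [mem_ofPred_eq] at hp ⊢
    rw [Real.norm_eq_abs, sq_abs]
    gcongr

/-- The regularized modulus. -/
def regNorm (ε : ℝ) (z : ℂ) : ℝ := Real.sqrt (‖z‖ ^ 2 + ε ^ 2) - ε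

lemma regNorm_nonneg (ε : ℝ) (z : ℂ) : 0 ≤ regNorm ε z :=
  sub_nonneg.2 (Real.le_sqrt_of_sq_le (by nlinarith [sq_nonneg ‖z‖]))

lemma regNorm_le {ε : ℝ} (hε : 0 < ε) (z : ℂ) : regNorm ε z ≤ ‖z‖ := by
  rw [regNorm, sub_le_iff_le_add]
  exact Real.sqrt_le_iff.2 ⟨by positivity, by nlinarith [norm_nonneg z]⟩

lemma le_regNorm {ε : ℝ} (z : ℂ) : ‖z‖ - ε ≤ regNorm ε z :=
  sub_le_sub_right (Real.le_sqrt_of_sq_le (by nlinarith [sq_nonneg ε])) _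

lemma contDiff_regNorm {ε : ℝ} (hε : 0 < ε) : ContDiff ℝ (⊤ : ℕ∞) (regNorm ε) := by
  refine ContDiff.sub (ContDiff.sqrt ((contDiff_norm_sq ℝ).add contDiff_const) fun z => ?_)
    contDiff_const
  positivity

lemma norm_fderiv_regNorm_le {ε : ℝ} (hε : 0 < ε) (z w : ℂ) :
    ‖fderiv ℝ (regNorm ε) z w‖ ≤ ‖w‖ := by
  have h : LipschitzWith 1 (regNorm ε) := by
    refine LipschitzWith.of_le_add fun z w => ?_
    have h1 : ‖z‖ ≤ ‖w‖ + dist z w := by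
      rw [dist_eq_norm]; linarith [norm_sub_norm_le z w]
    have h2 : ‖w‖ ≤ Real.sqrt (‖w‖ ^ 2 + ε ^ 2) :=
      Real.le_sqrt_of_sq_le (by nlinarith [sq_nonneg ε])
    have h3 : 0 ≤ dist z w := dist_nonneg
    have h4 : Real.sqrt (‖w‖ ^ 2 + ε ^ 2) ^ 2 = ‖w‖ ^ 2 + ε ^ 2 := Real.sq_sqrt (by positivity)
    have : Real.sqrt (‖z‖ ^ 2 + ε ^ 2) ≤ Real.sqrt (‖w‖ ^ 2 + ε ^ 2) + dist z w :=
      Real.sqrt_le_iff.2 ⟨by positivity, by nlinarith [norm_nonneg z, norm_nonneg w]⟩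
    unfold regNorm
    linarith
  simpa using (fderiv ℝ (regNorm ε) z).le_of_opNorm_le (norm_fderiv_le_of_lipschitz ℝ h) w

lemma PlaneTest.regNorm {f : ℝ × ℝ → ℂ} (hf : PlaneTest ω f) {ε : ℝ} (hε : 0 < ε) :
    PlaneTest ω (fun p => regNorm ε (f p)) :=
  hf.of_zero hf ((contDiff_regNorm hε).comp hf.smooth) fun p hp _ => by
    simp [_root_.regNorm, hp, Real.sqrt_sq hε.le]

/-- Smallness on a set of positive measure costs a definite amount of energy. -/
lemma exists_coercive (hω : IsOpen ω) (hc : IsConnected ω) (hf : volume ω ≠ ⊤)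
    {A : Set (ℝ × ℝ)} (hA : MeasurableSet A) (hAω : A ⊆ ω) (hA0 : volume A ≠ 0) :
    ∃ c > 0, ∀ f : ℝ × ℝ → ℂ, PlaneTest ω f →
      c * ∫ p, ‖f p‖ ^ 2 ≤ excess ω f + ∫ p in A, ‖f p‖ ^ 2 := by
  obtain ⟨c, hc0, h⟩ := exists_coercive_nonneg hω hc hf hA hAω hA0
  refine ⟨c, hc0, fun f hf => ?_⟩
  have hE := E1_nonneg ω
  have if1 : Integrable (fun p => ‖f p‖) :=
    hf.continuous.norm.integrable_of_hasCompactSupport hf.compact.norm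
  have idf : Integrable (fun p => ‖dx f p‖ ^ 2 + ‖dy f p‖ ^ 2) :=
    hf.integrable_dx.add hf.integrable_dy
  have h1 : 0 ≤ ∫ p, ‖f p‖ := integral_nonneg fun p => norm_nonneg _
  have key : ∀ ε > 0, (c + E1 ω) * ((∫ p, ‖f p‖ ^ 2) - 2 * ε * ∫ p, ‖f p‖)
      ≤ (∫ p, (‖dx f p‖ ^ 2 + ‖dy f p‖ ^ 2)) + ∫ p in A, ‖f p‖ ^ 2 := by
    intro ε hε
    have hg := hf.regNorm hε
    have := h _ hg fun p => regNorm_nonneg ε _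
    have hfd : ∀ p, fderiv ℝ (fun p => regNorm ε (f p)) p
        = (fderiv ℝ (regNorm ε) (f p)).comp (fderiv ℝ f p) := fun p =>
      fderiv_comp p ((contDiff_regNorm hε).differentiable (by simp) _) (hf.diff p)
    have e1 : ∫ p, (‖dx (fun p => regNorm ε (f p)) p‖ ^ 2
        + ‖dy (fun p => regNorm ε (f p)) p‖ ^ 2) ≤ ∫ p, (‖dx f p‖ ^ 2 + ‖dy f p‖ ^ 2) := by
      refine integral_mono (hg.integrable_dx.add hg.integrable_dy) idf fun p => ?_
      simp only [dx, dy, hfd, ContinuousLinearMap.comp_apply]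
      gcongr <;> exact norm_fderiv_regNorm_le hε _ _
    have e2 : ∫ p in A, ‖regNorm ε (f p)‖ ^ 2 ≤ ∫ p in A, ‖f p‖ ^ 2 := by
      refine integral_mono hg.integrable.integrableOn hf.integrable.integrableOn fun p => ?_
      simp only [Real.norm_eq_abs, abs_of_nonneg (regNorm_nonneg ε (f p))]
      gcongr
      exacts [regNorm_nonneg ε _, regNorm_le hε _]
    have e3 : (∫ p, ‖f p‖ ^ 2) - 2 * ε * ∫ p, ‖f p‖ ≤ ∫ p, ‖regNorm ε (f p)‖ ^ 2 := by
      rw [← integral_const_mul, ← integral_sub hf.integrable (if1.const_mul _)]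
      refine integral_mono (hf.integrable.sub (if1.const_mul _)) hg.integrable fun p => ?_
      have a := regNorm_nonneg ε (f p)
      have b := regNorm_le hε (f p)
      have d := le_regNorm (ε := ε) (f p)
      simp only [Real.norm_eq_abs, sq_abs]
      nlinarith
    have e4 : (c + E1 ω) * ((∫ p, ‖f p‖ ^ 2) - 2 * ε * ∫ p, ‖f p‖)
      ≤ (c + E1 ω) * ∫ p, ‖regNorm ε (f p)‖ ^ 2 := by gcongr
    unfold excess at this
    linarith
  set K := (c + E1 ω) * (2 * ∫ p, ‖f p‖) with hK
  have hK0 : 0 ≤ K := by positivity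
  have : (c + E1 ω) * ∫ p, ‖f p‖ ^ 2
      ≤ (∫ p, (‖dx f p‖ ^ 2 + ‖dy f p‖ ^ 2)) + ∫ p in A, ‖f p‖ ^ 2 := by
    refine le_of_forall_pos_le_add fun δ hδ => ?_
    have := key (δ / (K + 1)) (by positivity)
    have e : δ / (K + 1) * K ≤ δ := by
      rw [div_mul_eq_mul_div, div_le_iff₀ (by positivity)]; nlinarith
    rw [hK] at e
    nlinarith
  unfold excess
  linarith

end

section
variable {ω : Set (ℝ × ℝ)}

lemma rot_rot (a b : ℝ) (p : ℝ × ℝ) : rot a (rot b p) = rot (a + b) p := by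
  simp only [rot, cos_add, sin_add]
  ext <;> simp <;> ring

@[simp] lemma rot_zero (p : ℝ × ℝ) : rot 0 p = p := by simp [rot]

@[simp] lemma rot_neg_rot (a : ℝ) (p : ℝ × ℝ) : rot (-a) (rot a p) = p := by simp [rot_rot]

@[simp] lemma rot_rot_neg (a : ℝ) (p : ℝ × ℝ) : rot a (rot (-a) p) = p := by simp [rot_rot]

lemma continuous_rot : Continuous fun x : ℝ × ℝ × ℝ => rot x.1 x.2 := by
  unfold rot; fun_prop

/-- Rotation as a homeomorphism. -/
def rotHomeomorph (a : ℝ) : (ℝ × ℝ) ≃ₜ (ℝ × ℝ) where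
  toFun := rot a
  invFun := rot (-a)
  left_inv := rot_neg_rot a
  right_inv := rot_rot_neg a
  continuous_toFun := continuous_rot.comp (by fun_prop : Continuous fun p : ℝ × ℝ => (a, p))
  continuous_invFun := continuous_rot.comp (by fun_prop : Continuous fun p : ℝ × ℝ => (-a, p))

lemma measurePreserving_rot (a : ℝ) : MeasurePreserving (rot a) := by
  refine ⟨(rotHomeomorph a).continuous.measurable, ?_⟩
  set l := Matrix.toLin (Module.Basis.finTwoProd ℝ) (Module.Basis.finTwoProd ℝ)
    !![cos a, sin a; -sin a, cos a] with hl
  have hdet : LinearMap.det l = 1 := by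
    rw [hl, LinearMap.det_toLin, Matrix.det_fin_two_of]
    nlinarith [sin_sq_add_cos_sq a]
  have hrot : rot a = l := by
    ext p
    all_goals
      rw [hl, Matrix.toLin_finTwoProd_apply]
      simp only [rot]
      ring
  rw [hrot, Measure.map_linearMap_addHaar_eq_smul_addHaar _ (by simp [hdet])]
  simp [hdet]

lemma integral_comp_rot {F : Type*} [NormedAddCommGroup F] [NormedSpace ℝ F] (a : ℝ)
    (g : ℝ × ℝ → F) : ∫ p, g (rot a p) = ∫ p, g p :=
  (measurePreserving_rot a).integral_comp (rotHomeomorph a).measurableEmbedding g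

lemma hasDerivAt_rot {Ψ : ℝ → ℝ} {Ψ' t : ℝ} (h : HasDerivAt Ψ Ψ' t) (p : ℝ × ℝ) :
    HasDerivAt (fun t => rot (Ψ t) p) (Ψ' * (rot (Ψ t) p).2, -(Ψ' * (rot (Ψ t) p).1)) t := by
  unfold rot
  refine HasDerivAt.prodMk ?_ ?_
  · exact ((h.cos.const_mul p.1).add (h.sin.const_mul p.2)).congr_deriv (by simp; ring)
  · exact ((h.sin.const_mul (-p.1)).add (h.cos.const_mul p.2)).congr_deriv (by simp; ring)

/-- The straightening map of a twisted tube with twisting angle `Θ`. -/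
def twist (Θ : ℝ → ℝ) (hΘ : Continuous Θ) : (ℝ × ℝ × ℝ) ≃ₜ (ℝ × ℝ × ℝ) where
  toFun x := (x.1, rot (-Θ x.1) x.2)
  invFun x := (x.1, rot (Θ x.1) x.2)
  left_inv x := by simp
  right_inv x := by simp
  continuous_toFun := by unfold rot; fun_prop
  continuous_invFun := by unfold rot; fun_prop

@[simp] lemma twist_apply {Θ : ℝ → ℝ} (hΘ : Continuous Θ) (t : ℝ) (p : ℝ × ℝ) :
    twist Θ hΘ (t, p) = (t, rot (-Θ t) p) := rfl

lemma measurePreserving_twist {Θ : ℝ → ℝ} (hΘ : Continuous Θ) :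
    MeasurePreserving (twist Θ hΘ) := by
  have hm : Measurable (Function.uncurry fun t p => rot (-Θ t) p) := by
    refine Continuous.measurable ?_
    unfold rot Function.uncurry; fun_prop
  exact (MeasurePreserving.id (volume : Measure ℝ)).skew_product hm
    (Eventually.of_forall fun t => (measurePreserving_rot (-Θ t)).map_eq)

lemma integral_comp_twist {F : Type*} [NormedAddCommGroup F] [NormedSpace ℝ F] {Θ : ℝ → ℝ}
    (hΘ : Continuous Θ) (g : ℝ × ℝ × ℝ → F) : ∫ x, g (twist Θ hΘ x) = ∫ x, g x :=
  (measurePreserving_twist hΘ).integral_comp (twist Θ hΘ).measurableEmbedding g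

/-- The longitudinal derivative in a twisted tube. -/
def transport (σ : ℝ → ℝ) (v : ℝ × ℝ × ℝ → ℂ) (x : ℝ × ℝ × ℝ) : ℂ :=
  pd1 v x - σ x.1 • pdtau v x

section
variable {v : ℝ × ℝ × ℝ → ℂ}

lemma pd1_eq (hv : Differentiable ℝ v) (x : ℝ × ℝ × ℝ) : pd1 v x = fderiv ℝ v x (1, 0, 0) := by
  have h : HasDerivAt (fun t : ℝ => (t, x.2.1, x.2.2)) ((1 : ℝ), (0 : ℝ), (0 : ℝ)) x.1 :=
    (hasDerivAt_id x.1).prodMk ((hasDerivAt_const _ _).prodMk (hasDerivAt_const _ _))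
  exact ((hv x).hasFDerivAt.comp_hasDerivAt x.1 h).deriv

lemma pd2_eq (hv : Differentiable ℝ v) (x : ℝ × ℝ × ℝ) : pd2 v x = fderiv ℝ v x (0, 1, 0) := by
  have h : HasDerivAt (fun t : ℝ => (x.1, t, x.2.2)) ((0 : ℝ), (1 : ℝ), (0 : ℝ)) x.2.1 :=
    (hasDerivAt_const _ _).prodMk ((hasDerivAt_id x.2.1).prodMk (hasDerivAt_const _ _))
  exact ((hv x).hasFDerivAt.comp_hasDerivAt x.2.1 h).deriv

lemma pd3_eq (hv : Differentiable ℝ v) (x : ℝ × ℝ × ℝ) : pd3 v x = fderiv ℝ v x (0, 0, 1) := by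
  have h : HasDerivAt (fun t : ℝ => (x.1, x.2.1, t)) ((0 : ℝ), (0 : ℝ), (1 : ℝ)) x.2.2 :=
    (hasDerivAt_const _ _).prodMk ((hasDerivAt_const _ _).prodMk (hasDerivAt_id x.2.2))
  exact ((hv x).hasFDerivAt.comp_hasDerivAt x.2.2 h).deriv

lemma pd2_fiber (hv : Differentiable ℝ v) (t : ℝ) (p : ℝ × ℝ) :
    dx (fun p => v (t, p)) p = pd2 v (t, p) := by
  have h : HasFDerivAt (fun p : ℝ × ℝ => (t, p)) (ContinuousLinearMap.inr ℝ ℝ (ℝ × ℝ)) p :=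
    hasFDerivAt_prodMk_right t p
  have e : fderiv ℝ (fun p => v (t, p)) p = _ := ((hv (t, p)).hasFDerivAt.comp p h).fderiv
  rw [pd2_eq hv, dx, e]
  simp

lemma pd3_fiber (hv : Differentiable ℝ v) (t : ℝ) (p : ℝ × ℝ) :
    dy (fun p => v (t, p)) p = pd3 v (t, p) := by
  have h : HasFDerivAt (fun p : ℝ × ℝ => (t, p)) (ContinuousLinearMap.inr ℝ ℝ (ℝ × ℝ)) p :=
    hasFDerivAt_prodMk_right t p
  have e : fderiv ℝ (fun p => v (t, p)) p = _ := ((hv (t, p)).hasFDerivAt.comp p h).fderiv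
  rw [pd3_eq hv, dy, e]
  simp

lemma transport_eq (hv : Differentiable ℝ v) (σ : ℝ → ℝ) (x : ℝ × ℝ × ℝ) :
    transport σ v x = fderiv ℝ v x (1, -(σ x.1 * x.2.2), σ x.1 * x.2.1) := by
  have : ((1 : ℝ), -(σ x.1 * x.2.2), σ x.1 * x.2.1)
      = (1, 0, 0) - σ x.1 • (x.2.2 • (0, 1, 0) - x.2.1 • ((0 : ℝ), (0 : ℝ), (1 : ℝ))) := by
    ext <;> simp
  rw [this, map_sub, map_smul, map_sub, map_smul, map_smul, transport, pdtau, pd1_eq hv,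
    pd2_eq hv, pd3_eq hv]

lemma hasDerivAt_comp_twist (hv : Differentiable ℝ v) {Θ σ : ℝ → ℝ} (hΘ : Continuous Θ)
    (h : ∀ t, HasDerivAt Θ (σ t) t) (p : ℝ × ℝ) (t : ℝ) :
    HasDerivAt (fun t => v (twist Θ hΘ (t, p))) (transport σ v (twist Θ hΘ (t, p))) t := by
  rw [transport_eq hv]
  refine (hv _).hasFDerivAt.comp_hasDerivAt t ?_
  refine ((hasDerivAt_id t).prodMk (hasDerivAt_rot (h t).neg p)).congr_deriv ?_
  simp

variable (hv : IsTest3 (Omega0 ω) v)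
include hv

lemma IsTest3.diff : Differentiable ℝ v := hv.1.differentiable (by simp)

lemma IsTest3.continuous_fderiv : Continuous (fderiv ℝ v) := hv.1.continuous_fderiv (by simp)

lemma IsTest3.zero_of_notMem {x : ℝ × ℝ × ℝ} (hx : x ∉ Omega0 ω) : v x = 0 :=
  image_eq_zero_of_notMem_tsupport fun h => hx (hv.2.2 h)

lemma IsTest3.fderiv_zero_of_notMem {x : ℝ × ℝ × ℝ} (hx : x ∉ Omega0 ω) : fderiv ℝ v x = 0 :=
  image_eq_zero_of_notMem_tsupport fun h => hx (hv.2.2 (tsupport_fderiv_subset ℝ h))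

lemma IsTest3.hasCompactSupport_of {F : Type*} [Zero F] {g : ℝ × ℝ × ℝ → F}
    (h : ∀ x, v x = 0 → fderiv ℝ v x = 0 → g x = 0) : HasCompactSupport g := by
  refine HasCompactSupport.intro' (hv.2.1.isCompact.union (hv.2.1.fderiv ℝ).isCompact)
    ((isClosed_tsupport _).union (isClosed_tsupport _)) fun x hx => ?_
  rw [mem_union, not_or] at hx
  exact h x (image_eq_zero_of_notMem_tsupport hx.1) (image_eq_zero_of_notMem_tsupport hx.2)

lemma IsTest3.integrable_of {F : Type*} [NormedAddCommGroup F] {g : ℝ × ℝ × ℝ → F}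
    (hg : Continuous g) (h : ∀ x, v x = 0 → fderiv ℝ v x = 0 → g x = 0) : Integrable g :=
  hg.integrable_of_hasCompactSupport (hv.hasCompactSupport_of h)

lemma IsTest3.setIntegral_eq {F : Type*} [NormedAddCommGroup F] [NormedSpace ℝ F]
    {g : ℝ × ℝ × ℝ → F} (h : ∀ x, v x = 0 → fderiv ℝ v x = 0 → g x = 0) :
    ∫ x in Omega0 ω, g x = ∫ x, g x :=
  setIntegral_eq_integral_of_forall_compl_eq_zero fun x hx =>
    h x (hv.zero_of_notMem hx) (hv.fderiv_zero_of_notMem hx)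

lemma IsTest3.continuous_transport {σ : ℝ → ℝ} (hσ : Continuous σ) :
    Continuous (transport σ v) := by
  rw [funext (transport_eq hv.diff σ)]
  exact hv.continuous_fderiv.clm_apply (by fun_prop)

lemma IsTest3.transport_zero {x : ℝ × ℝ × ℝ} (h : fderiv ℝ v x = 0) (σ : ℝ → ℝ) :
    transport σ v x = 0 := by
  simp [transport_eq hv.diff, h]

lemma IsTest3.continuous_pd2 : Continuous (pd2 v) := by
  rw [funext (pd2_eq hv.diff)]
  exact hv.continuous_fderiv.clm_apply continuous_const

lemma IsTest3.continuous_pd3 : Continuous (pd3 v) := by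
  rw [funext (pd3_eq hv.diff)]
  exact hv.continuous_fderiv.clm_apply continuous_const

lemma IsTest3.fiber (t : ℝ) : PlaneTest ω (fun p => v (t, p)) where
  smooth := hv.1.comp (contDiff_const.prodMk contDiff_id)
  compact := hv.2.1.comp_isClosedEmbedding (isClosedEmbedding_pair_left t)
  supp := (tsupport_comp_subset_preimage v (by fun_prop : Continuous fun p : ℝ × ℝ => (t, p))).trans
    fun _ hp => hv.2.2 hp

end

/-- The total shifted transverse energy. -/
def transverse (ω : Set (ℝ × ℝ)) (v : ℝ × ℝ × ℝ → ℂ) : ℝ :=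
  (∫ x, (‖pd2 v x‖ ^ 2 + ‖pd3 v x‖ ^ 2)) - E1 ω * ∫ x, ‖v x‖ ^ 2

/-- The defect of `v` from being a Gaussian along the flow lines. -/
def gaussDefect (σ : ℝ → ℝ) (v : ℝ × ℝ × ℝ → ℂ) : ℝ :=
  ∫ x, ‖transport σ v x + (x.1 / 4) • v x‖ ^ 2

section
variable {v : ℝ × ℝ × ℝ → ℂ} (hv : IsTest3 (Omega0 ω) v)
include hv

lemma IsTest3.integrable_norm_sq : Integrable (fun x => ‖v x‖ ^ 2) :=
  _root_.integrable_norm_sq hv.1.continuous hv.2.1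

lemma IsTest3.integrable_energy : Integrable (fun x => ‖pd2 v x‖ ^ 2 + ‖pd3 v x‖ ^ 2) :=
  hv.integrable_of ((hv.continuous_pd2.norm.pow 2).add (hv.continuous_pd3.norm.pow 2))
    fun x _ h => by simp [pd2_eq hv.diff, pd3_eq hv.diff, h]

lemma IsTest3.integrable_excess : Integrable (fun t => excess ω fun p => v (t, p)) := by
  simp only [excess, pd2_fiber hv.diff, pd3_fiber hv.diff]
  have h1 := hv.integrable_energy
  have h2 := hv.integrable_norm_sq
  rw [Measure.volume_eq_prod] at h1 h2
  exact h1.integral_prod_left.sub (h2.integral_prod_left.const_mul _)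

lemma IsTest3.transverse_eq : transverse ω v = ∫ t, excess ω fun p => v (t, p) := by
  have h1 := hv.integrable_energy
  have h2 := hv.integrable_norm_sq
  rw [Measure.volume_eq_prod] at h1 h2
  simp only [excess, pd2_fiber hv.diff, pd3_fiber hv.diff]
  rw [integral_sub h1.integral_prod_left (h2.integral_prod_left.const_mul _),
    integral_const_mul, transverse, Measure.volume_eq_prod, integral_prod _ h1, integral_prod _ h2]

lemma IsTest3.transverse_nonneg : 0 ≤ transverse ω v := by
  rw [hv.transverse_eq]
  exact integral_nonneg fun t => excess_nonneg (hv.fiber t)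

lemma IsTest3.integrable_gaussDefect {σ : ℝ → ℝ} (hσ : Continuous σ) :
    Integrable (fun x => ‖transport σ v x + (x.1 / 4) • v x‖ ^ 2) := by
  have := hv.continuous_transport hσ
  have := hv.1.continuous
  exact hv.integrable_of (by fun_prop) fun x h0 h => by simp [hv.transport_zero h, h0]

lemma IsTest3.integrable_transport {σ : ℝ → ℝ} (hσ : Continuous σ) :
    Integrable (fun x => ‖transport σ v x‖ ^ 2) := by
  have := hv.continuous_transport hσ
  exact hv.integrable_of (by fun_prop) fun x _ h => by simp [hv.transport_zero h]

lemma IsTest3.integrable_moment : Integrable (fun x => x.1 ^ 2 * ‖v x‖ ^ 2) := by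
  have := hv.1.continuous
  exact hv.integrable_of (by fun_prop) fun x h0 h => by simp [h0]

lemma IsTest3.virial {Θ σ : ℝ → ℝ} (hσ : Continuous σ) (h : ∀ t, HasDerivAt Θ (σ t) t) :
    ∫ x, (‖v x‖ ^ 2 + x.1 * (2 * inner ℝ (v x) (transport σ v x))) = 0 := by
  have hΘ : Continuous Θ := continuous_iff_continuousAt.2 fun t => (h t).continuousAt
  have hc := hv.continuous_transport hσ
  have hvc := hv.1.continuous
  have hGc : Continuous fun x : ℝ × ℝ × ℝ =>
    ‖v x‖ ^ 2 + x.1 * (2 * inner ℝ (v x) (transport σ v x)) := by fun_prop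
  have hGs : HasCompactSupport fun x : ℝ × ℝ × ℝ =>
    ‖v x‖ ^ 2 + x.1 * (2 * inner ℝ (v x) (transport σ v x)) :=
    hv.hasCompactSupport_of fun x h0 _ => by simp [h0]
  have hFs : HasCompactSupport fun x : ℝ × ℝ × ℝ => x.1 * ‖v x‖ ^ 2 :=
    hv.hasCompactSupport_of fun x h0 _ => by simp [h0]
  have hT := (twist Θ hΘ).isClosedEmbedding
  have iG := (hGc.comp (twist Θ hΘ).continuous).integrable_of_hasCompactSupport
    (μ := volume) (hGs.comp_isClosedEmbedding hT)
  rw [← integral_comp_twist hΘ, Measure.volume_eq_prod]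
  refine (integral_prod_symm _ iG).trans ?_
  refine integral_eq_zero_of_ae (Eventually.of_forall fun p => ?_)
  have hp := isClosedEmbedding_pair_right (X := ℝ) p
  have hFp := ((hFs.comp_isClosedEmbedding hT).comp_isClosedEmbedding hp)
  have hGp := ((hGs.comp_isClosedEmbedding hT).comp_isClosedEmbedding hp)
  refine integral_eq_zero_of_hasDerivAt_of_integrable
    (f := fun t => t * ‖v (twist Θ hΘ (t, p))‖ ^ 2) (fun t => ?_) ?_ ?_
  · have := (hasDerivAt_comp_twist hv.diff hΘ h p t).norm_sq
    exact ((hasDerivAt_id t).mul this).congr_deriv (by simp)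
  · exact ((hGc.comp (twist Θ hΘ).continuous).comp hp.continuous).integrable_of_hasCompactSupport
      hGp
  · exact Continuous.integrable_of_hasCompactSupport (by fun_prop) hFp

lemma IsTest3.norm_transport_add {Θ σ : ℝ → ℝ} (hσ : Continuous σ)
    (h : ∀ t, HasDerivAt Θ (σ t) t) :
    (∫ x, ‖transport σ v x‖ ^ 2) + 1 / 16 * ∫ x, x.1 ^ 2 * ‖v x‖ ^ 2
      = gaussDefect σ v + 1 / 4 * ∫ x, ‖v x‖ ^ 2 := by
  have hc := hv.continuous_transport hσ
  have hvc := hv.1.continuous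
  have hG : Integrable fun x : ℝ × ℝ × ℝ =>
      ‖v x‖ ^ 2 + x.1 * (2 * inner ℝ (v x) (transport σ v x)) :=
    hv.integrable_of (by fun_prop) fun x h0 _ => by simp [h0]
  have hA := hv.integrable_transport hσ
  have hB := hv.integrable_moment
  have hM := hv.integrable_norm_sq
  have hD := hv.integrable_gaussDefect hσ
  have h0 := hv.virial hσ h
  have e : (∫ x, (‖transport σ v x + (x.1 / 4) • v x‖ ^ 2 + 1 / 4 * ‖v x‖ ^ 2))
      = ∫ x, ((‖transport σ v x‖ ^ 2 + 1 / 16 * (x.1 ^ 2 * ‖v x‖ ^ 2))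
        + 1 / 4 * (‖v x‖ ^ 2 + x.1 * (2 * inner ℝ (v x) (transport σ v x)))) := by
    congr 1; ext x
    rw [norm_add_sq_real, norm_smul, inner_smul_right, real_inner_comm, mul_pow,
      Real.norm_eq_abs, sq_abs]
    ring
  have hAB : Integrable fun x => ‖transport σ v x‖ ^ 2 + 1 / 16 * (x.1 ^ 2 * ‖v x‖ ^ 2) :=
    hA.add (hB.const_mul _)
  rw [integral_add hD (hM.const_mul _), integral_add hAB (hG.const_mul _),
    integral_add hA (hB.const_mul _), integral_const_mul, integral_const_mul,
    integral_const_mul, h0] at e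
  unfold gaussDefect
  linarith

end

lemma gaussDefect_nonneg (σ : ℝ → ℝ) (v : ℝ × ℝ × ℝ → ℂ) : 0 ≤ gaussDefect σ v :=
  integral_nonneg fun x => by positivity

lemma IsTest3.Jform_eq {v : ℝ × ℝ × ℝ → ℂ} (hv : IsTest3 (Omega0 ω) v) {θ Θ : ℝ → ℝ} {s : ℝ}
    (hσ : Continuous (sigmafun θ s)) (h : ∀ t, HasDerivAt Θ (sigmafun θ s t) t) :
    Jform θ ω s v = 1 / 4 * (∫ x, ‖v x‖ ^ 2) + gaussDefect (sigmafun θ s) v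
      + Real.exp s * transverse ω v := by
  have e1 : ∫ y in Omega0 ω, ‖pd1 v y - sigmafun θ s y.1 • pdtau v y‖ ^ 2
      = ∫ x, ‖transport (sigmafun θ s) v x‖ ^ 2 :=
    hv.setIntegral_eq (g := fun x => ‖transport (sigmafun θ s) v x‖ ^ 2)
      fun x _ h => by simp [hv.transport_zero h]
  have e2 : ∫ y in Omega0 ω, y.1 ^ 2 * ‖v y‖ ^ 2 = ∫ y, y.1 ^ 2 * ‖v y‖ ^ 2 :=
    hv.setIntegral_eq fun x h _ => by simp [h]
  have e3 : ∫ y in Omega0 ω, (‖pd2 v y‖ ^ 2 + ‖pd3 v y‖ ^ 2)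
      = ∫ y, (‖pd2 v y‖ ^ 2 + ‖pd3 v y‖ ^ 2) :=
    hv.setIntegral_eq fun x _ h => by simp [pd2_eq hv.diff, pd3_eq hv.diff, h]
  have e4 : ∫ y in Omega0 ω, ‖v y‖ ^ 2 = ∫ y, ‖v y‖ ^ 2 :=
    hv.setIntegral_eq fun x h _ => by simp [h]
  rw [Jform, e1, e2, e3, e4, hv.norm_transport_add hσ h, transverse]
  ring

end

section
variable {ω : Set (ℝ × ℝ)}

lemma exists_rot_diff {ω : Set (ℝ × ℝ)} (hω : IsOpen ω) (hf : volume ω ≠ ⊤) {ϑ : ℝ} (hϑ : 0 < ϑ)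
    (h : volume (symmDiff (rot ϑ '' ω) ω) ≠ 0) {δ : ℝ} (hδ : 0 < δ) :
    ∃ β, 0 < β ∧ β < δ ∧ volume {p | p ∈ ω ∧ rot (-β) p ∉ ω} ≠ 0 := by
  obtain ⟨n, hn⟩ := exists_nat_gt (ϑ / δ)
  have hn0 : (0 : ℝ) < n := (div_pos hϑ hδ).trans hn
  refine ⟨ϑ / n, by positivity, by rwa [div_lt_comm₀ hn0 hδ], fun h0 => h ?_⟩
  have h1 : ω ≤ᵐ[volume] rot (-(ϑ / n)) ⁻¹' ω := by
    rw [ae_le_set]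
    exact h0
  have hk : ∀ k : ℕ, ω ≤ᵐ[volume] rot (-(k * (ϑ / n))) ⁻¹' ω := by
    intro k
    induction k with
    | zero =>
      refine Eventually.of_forall fun p hp => ?_
      have e : rot (-(((0 : ℕ) : ℝ) * (ϑ / n))) p = p := by simp
      exact (congrArg (· ∈ ω) e).mpr hp
    | succ k ih =>
      refine ih.trans ?_
      have := (measurePreserving_rot (-(k * (ϑ / n)))).quasiMeasurePreserving.preimage_mono_ae h1
      refine this.trans (Eventually.of_forall fun p hp => ?_)
      change rot _ p ∈ ω
      change rot _ (rot _ p) ∈ ω at hp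
      rw [rot_rot] at hp
      convert hp using 2
      push_cast; ring
  have himg : rot ϑ '' ω = rot (-ϑ) ⁻¹' ω :=
    (rotHomeomorph ϑ).toEquiv.image_eq_preimage_symm ω
  have hle := hk n
  rw [mul_div_cancel₀ _ hn0.ne', ← himg] at hle
  have hmeas : volume (rot ϑ '' ω) = volume ω := by
    rw [himg, (measurePreserving_rot (-ϑ)).measure_preimage hω.measurableSet.nullMeasurableSet]
  rw [measure_symmDiff_eq_zero_iff]
  exact (ae_eq_of_ae_subset_of_measure_ge hle hmeas.le hω.measurableSet.nullMeasurableSet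
    (hmeas.trans_ne hf)).symm

section
variable {v : ℝ × ℝ × ℝ → ℂ} (hv : IsTest3 (Omega0 ω) v) {Θ σ : ℝ → ℝ}
include hv

lemma IsTest3.integrable_flow (t z a b : ℝ) (c d : ℝ) :
    Integrable fun p => ‖c • v (t, rot a p) - d • v (z, rot b p)‖ ^ 2 := by
  have h : ∀ t a, HasCompactSupport fun p => v (t, rot a p) := fun t a =>
    (hv.fiber t).compact.comp_isClosedEmbedding (rotHomeomorph a).isClosedEmbedding
  have hc : ∀ t a, Continuous fun p => v (t, rot a p) := fun t a =>
    (hv.fiber t).continuous.comp (rotHomeomorph a).continuous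
  exact _root_.integrable_norm_sq (((hc t a).const_smul c).sub ((hc z b).const_smul d))
    (((h t a).smul_left (f := fun _ => c)).sub ((h z b).smul_left (f := fun _ => d)))

/-- Along the flow lines, `v` is close to a Gaussian. -/
lemma IsTest3.flow_le (hσ : Continuous σ) (h : ∀ t, HasDerivAt Θ (σ t) t) {R t z : ℝ}
    (ht : |t| ≤ R) (hz : |z| ≤ R) :
    ∫ p, ‖exp (t ^ 2 / 8) • v (t, rot (-Θ t) p) - exp (z ^ 2 / 8) • v (z, rot (-Θ z) p)‖ ^ 2
      ≤ 2 * R * exp (R ^ 2 / 4) * gaussDefect σ v := by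
  have hΘ : Continuous Θ := continuous_iff_continuousAt.2 fun t => (h t).continuousAt
  have hc := hv.continuous_transport hσ
  have hvc := hv.1.continuous
  have hR : 0 ≤ R := (abs_nonneg t).trans ht
  set a : ℝ × ℝ × ℝ → ℂ := fun x => transport σ v x + (x.1 / 4) • v x with ha
  have hac : Continuous a := by fun_prop
  have has : HasCompactSupport a :=
    hv.hasCompactSupport_of fun x h0 h => by simp [ha, hv.transport_zero h, h0]
  have hT := (twist Θ hΘ).isClosedEmbedding
  have hiD : Integrable (fun x => ‖a (twist Θ hΘ x)‖ ^ 2) :=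
    _root_.integrable_norm_sq (hac.comp (twist Θ hΘ).continuous) (has.comp_isClosedEmbedding hT)
  have hD : gaussDefect σ v = ∫ p, ∫ t, ‖a (twist Θ hΘ (t, p))‖ ^ 2 := by
    rw [gaussDefect, ← integral_comp_twist hΘ, Measure.volume_eq_prod]
    exact integral_prod_symm _ hiD
  rw [hD, ← integral_const_mul]
  rw [Measure.volume_eq_prod] at hiD
  refine integral_mono_of_nonneg (Eventually.of_forall fun p => by positivity)
    (hiD.integral_prod_right.const_mul _) (Eventually.of_forall fun p => ?_)
  have hd : ∀ τ, HasDerivAt (fun τ => exp (τ ^ 2 / 8) • v (twist Θ hΘ (τ, p)))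
      (exp (τ ^ 2 / 8) • a (twist Θ hΘ (τ, p))) τ := by
    intro τ
    have h1 : HasDerivAt (fun τ : ℝ => exp (τ ^ 2 / 8)) (exp (τ ^ 2 / 8) * (τ / 4)) τ :=
      (((hasDerivAt_id τ).pow 2).div_const 8).exp.congr_deriv (by simp; ring)
    refine (h1.smul (hasDerivAt_comp_twist hv.diff hΘ h p τ)).congr_deriv ?_
    simp only [ha, twist_apply, smul_add, smul_smul]
  have hp := isClosedEmbedding_pair_right (X := ℝ) p
  have hcτ : Continuous fun τ => a (twist Θ hΘ (τ, p)) :=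
    (hac.comp (twist Θ hΘ).continuous).comp hp.continuous
  have hiτ : Integrable fun τ => ‖a (twist Θ hΘ (τ, p))‖ ^ 2 :=
    _root_.integrable_norm_sq hcτ ((has.comp_isClosedEmbedding hT).comp_isClosedEmbedding hp)
  have hle := sq_norm_sub_le (abs_le.1 ht) (abs_le.1 hz) hd (by fun_prop)
  simp only [twist_apply] at hle
  refine hle.trans ?_
  change _ ≤ 2 * R * exp (R ^ 2 / 4) * ∫ t, ‖a (twist Θ hΘ (t, p))‖ ^ 2
  rw [show R - -R = 2 * R by ring, mul_assoc (2 * R)]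
  gcongr
  calc ∫ τ in Icc (-R) R, ‖exp (τ ^ 2 / 8) • a (τ, rot (-Θ τ) p)‖ ^ 2
      ≤ ∫ τ in Icc (-R) R, exp (R ^ 2 / 4) * ‖a (twist Θ hΘ (τ, p))‖ ^ 2 := by
        refine setIntegral_mono_on ?_ (hiτ.const_mul _).integrableOn measurableSet_Icc
          fun τ hτ => ?_
        · refine Continuous.integrableOn_Icc ?_
          exact (((by fun_prop : Continuous fun τ : ℝ => exp (τ ^ 2 / 8)).smul hcτ).norm).pow 2
        · rw [norm_smul, mul_pow, Real.norm_eq_abs, abs_exp, ← exp_nat_mul, twist_apply]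
          have : τ ^ 2 ≤ R ^ 2 := sq_le_sq' hτ.1 hτ.2
          gcongr
          push_cast; linarith
    _ ≤ ∫ τ, exp (R ^ 2 / 4) * ‖a (twist Θ hΘ (τ, p))‖ ^ 2 :=
        setIntegral_le_integral (hiτ.const_mul _) (Eventually.of_forall fun τ => by positivity)
    _ = _ := integral_const_mul _ _

lemma IsTest3.mass_le (hσ : Continuous σ) (h : ∀ t, HasDerivAt Θ (σ t) t) {R t z : ℝ}
    (ht : |t| ≤ R) (hz : |z| ≤ R) :
    ∫ p, ‖v (t, p)‖ ^ 2 ≤ 2 * exp (R ^ 2 / 4) * (∫ p, ‖v (z, p)‖ ^ 2)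
      + 2 * (2 * R * exp (R ^ 2 / 4) * gaussDefect σ v) := by
  have hfl := hv.flow_le hσ h ht hz
  have hi := hv.integrable_flow t z (-Θ t) (-Θ z) (exp (t ^ 2 / 8)) (exp (z ^ 2 / 8))
  have hir : ∀ t a, Integrable fun p => ‖v (t, rot a p)‖ ^ 2 := fun t a => by
    simpa using hv.integrable_flow t t a a 1 0
  rw [← integral_comp_rot (-Θ t) fun p => ‖v (t, p)‖ ^ 2,
    ← integral_comp_rot (-Θ z) fun p => ‖v (z, p)‖ ^ 2]
  calc ∫ p, ‖v (t, rot (-Θ t) p)‖ ^ 2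
      ≤ ∫ p, (2 * exp (R ^ 2 / 4) * ‖v (z, rot (-Θ z) p)‖ ^ 2
          + 2 * ‖exp (t ^ 2 / 8) • v (t, rot (-Θ t) p)
            - exp (z ^ 2 / 8) • v (z, rot (-Θ z) p)‖ ^ 2) := by
        refine integral_mono (hir _ _) (((hir _ _).const_mul _).add (hi.const_mul _)) fun p => ?_
        set x := v (t, rot (-Θ t) p)
        set y := v (z, rot (-Θ z) p)
        have h1 : ‖x‖ ≤ ‖exp (t ^ 2 / 8) • x‖ := by
          rw [norm_smul, Real.norm_eq_abs, abs_exp]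
          exact le_mul_of_one_le_left (norm_nonneg _) (one_le_exp (by positivity))
        have h2 : ‖exp (t ^ 2 / 8) • x‖ ≤ ‖exp (t ^ 2 / 8) • x - exp (z ^ 2 / 8) • y‖
            + ‖exp (z ^ 2 / 8) • y‖ := by
          linarith [norm_sub_norm_le (exp (t ^ 2 / 8) • x) (exp (z ^ 2 / 8) • y)]
        have h3 : ‖exp (z ^ 2 / 8) • y‖ ^ 2 ≤ exp (R ^ 2 / 4) * ‖y‖ ^ 2 := by
          rw [norm_smul, mul_pow, Real.norm_eq_abs, abs_exp, ← exp_nat_mul]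
          have : z ^ 2 ≤ R ^ 2 := sq_le_sq' (abs_le.1 hz).1 (abs_le.1 hz).2
          gcongr
          push_cast; linarith
        have h4 : ‖x‖ ^ 2 ≤ (‖exp (t ^ 2 / 8) • x - exp (z ^ 2 / 8) • y‖
            + ‖exp (z ^ 2 / 8) • y‖) ^ 2 := by
          gcongr; exact h1.trans h2
        change ‖x‖ ^ 2 ≤ 2 * exp (R ^ 2 / 4) * ‖y‖ ^ 2 + 2 * ‖_‖ ^ 2
        nlinarith [sq_nonneg (‖exp (t ^ 2 / 8) • x - exp (z ^ 2 / 8) • y‖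
            - ‖exp (z ^ 2 / 8) • y‖)]
    _ = 2 * exp (R ^ 2 / 4) * (∫ p, ‖v (z, rot (-Θ z) p)‖ ^ 2)
          + 2 * ∫ p, ‖exp (t ^ 2 / 8) • v (t, rot (-Θ t) p)
            - exp (z ^ 2 / 8) • v (z, rot (-Θ z) p)‖ ^ 2 := by
        rw [integral_add ((hir _ _).const_mul _) (hi.const_mul _), integral_const_mul,
          integral_const_mul]
    _ ≤ _ := by gcongr

/-- Where the flow line leaves the tube, `v` is controlled by its defect. -/
lemma IsTest3.exit_le (hω : IsOpen ω) (hσ : Continuous σ) (h : ∀ t, HasDerivAt Θ (σ t) t)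
    {R t z β : ℝ} (ht : |t| ≤ R) (hz : |z| ≤ R) (hβ : Θ t = Θ z + β) :
    ∫ p in {p | p ∈ ω ∧ rot (-β) p ∉ ω}, ‖v (z, p)‖ ^ 2
      ≤ 2 * R * exp (R ^ 2 / 4) * gaussDefect σ v := by
  refine le_trans ?_ (hv.flow_le hσ h hz ht)
  rw [← integral_comp_rot (Θ z)]
  simp only [rot_neg_rot]
  simp only [rot_rot]
  have hi : Integrable fun p => ‖exp (z ^ 2 / 8) • v (z, p)
      - exp (t ^ 2 / 8) • v (t, rot (-Θ t + Θ z) p)‖ ^ 2 := by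
    simpa only [rot_zero] using hv.integrable_flow z t 0 (-Θ t + Θ z) (exp (z ^ 2 / 8)) (exp (t ^ 2 / 8))
  have hA : MeasurableSet {p | p ∈ ω ∧ rot (-β) p ∉ ω} :=
    hω.measurableSet.inter ((rotHomeomorph (-β)).continuous.measurable hω.measurableSet).compl
  refine le_trans (setIntegral_mono_on (hv.fiber z).integrable.integrableOn hi.integrableOn hA
    fun p hp => ?_) (setIntegral_le_integral hi (Eventually.of_forall fun p => by positivity))
  have h0 : v (t, rot (-Θ t + Θ z) p) = 0 := by
    rw [hβ, show -(Θ z + β) + Θ z = -β by ring]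
    exact hv.zero_of_notMem hp.2
  rw [h0, smul_zero, sub_zero, norm_smul, Real.norm_eq_abs, abs_exp]
  gcongr
  exact le_mul_of_one_le_left (norm_nonneg _) (one_le_exp (by positivity))

lemma IsTest3.integrable_mass : Integrable fun t => ∫ p, ‖v (t, p)‖ ^ 2 := by
  have h2 := hv.integrable_norm_sq
  rw [Measure.volume_eq_prod] at h2
  exact h2.integral_prod_left

lemma IsTest3.localize (hσ : Continuous σ) (h : ∀ t, HasDerivAt Θ (σ t) t) {R : ℝ} (hR : 4 ≤ R) :
    ∫ x, ‖v x‖ ^ 2 ≤ 2 * (∫ t in Icc (-R) R, ∫ p, ‖v (t, p)‖ ^ 2) + 2 * gaussDefect σ v := by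
  have h1 := hv.norm_transport_add hσ h
  have h0 : 0 ≤ ∫ x, ‖transport σ v x‖ ^ 2 := integral_nonneg fun x => by positivity
  have hM := hv.integrable_norm_sq
  have hm := hv.integrable_mass
  have hB := hv.integrable_moment
  have hM2 : ∫ x, ‖v x‖ ^ 2 = ∫ t, ∫ p, ‖v (t, p)‖ ^ 2 := by
    rw [Measure.volume_eq_prod] at hM ⊢
    exact integral_prod _ hM
  have hB2 : ∫ x, x.1 ^ 2 * ‖v x‖ ^ 2 = ∫ t, t ^ 2 * ∫ p, ‖v (t, p)‖ ^ 2 := by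
    simp_rw [← integral_const_mul]
    rw [Measure.volume_eq_prod] at hB ⊢
    exact integral_prod _ hB
  have hBi : Integrable fun t => t ^ 2 * ∫ p, ‖v (t, p)‖ ^ 2 := by
    simp_rw [← integral_const_mul]
    rw [Measure.volume_eq_prod] at hB
    exact hB.integral_prod_left
  have hmi : Integrable ((Icc (-R) R).indicator fun t => ∫ p, ‖v (t, p)‖ ^ 2) :=
    hm.indicator measurableSet_Icc
  have hle : ∫ t, ∫ p, ‖v (t, p)‖ ^ 2 ≤ ∫ t, ((Icc (-R) R).indicator
      (fun t => ∫ p, ‖v (t, p)‖ ^ 2) t + 1 / 16 * (t ^ 2 * ∫ p, ‖v (t, p)‖ ^ 2)) := by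
    refine integral_mono hm (hmi.add (hBi.const_mul _)) fun t => ?_
    have hmt : 0 ≤ ∫ p, ‖v (t, p)‖ ^ 2 := integral_nonneg fun p => by positivity
    by_cases ht : t ∈ Icc (-R) R
    · simp only [indicator_of_mem ht]
      have : 0 ≤ t ^ 2 * ∫ p, ‖v (t, p)‖ ^ 2 := by positivity
      linarith
    · simp only [indicator_of_notMem ht]
      have : 16 ≤ t ^ 2 := by
        rw [mem_Icc, ← abs_le, not_le] at ht
        rw [← sq_abs]; nlinarith
      nlinarith
  rw [integral_add hmi (hBi.const_mul _), integral_indicator measurableSet_Icc,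
    integral_const_mul, ← hB2, ← hM2] at hle
  have hS : 0 ≤ ∫ t in Icc (-R) R, ∫ p, ‖v (t, p)‖ ^ 2 :=
    integral_nonneg fun t => integral_nonneg fun p => by positivity
  linarith [gaussDefect_nonneg σ v]

end

lemma exists_mass_le (hω : IsOpen ω) (hc : IsConnected ω) (hf : volume ω ≠ ⊤) {Θ σ : ℝ → ℝ}
    (hσ : Continuous σ) (h : ∀ t, HasDerivAt Θ (σ t) t) {a b β : ℝ} (hβ0 : 0 < β)
    (hβ : β < Θ b - Θ a) (hA0 : volume {p | p ∈ ω ∧ rot (-β) p ∉ ω} ≠ 0) :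
    ∃ K > 0, ∀ v : ℝ × ℝ × ℝ → ℂ, IsTest3 (Omega0 ω) v →
      ∫ x, ‖v x‖ ^ 2 ≤ K * (gaussDefect σ v + transverse ω v) := by
  have hΘ : Continuous Θ := continuous_iff_continuousAt.2 fun t => (h t).continuousAt
  have hA : MeasurableSet {p | p ∈ ω ∧ rot (-β) p ∉ ω} :=
    hω.measurableSet.inter ((rotHomeomorph (-β)).continuous.measurable hω.measurableSet).compl
  obtain ⟨c, hc0, hcoer⟩ := exists_coercive hω hc hf hA (fun p hp => hp.1) hA0
  obtain ⟨δ, hδ, hnear⟩ := Metric.continuousAt_iff.1 hΘ.continuousAt (min β (Θ b - Θ a - β))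
    (lt_min hβ0 (sub_pos.2 hβ))
  set η := min (δ / 2) 1 with hη
  have hη0 : 0 < η := by positivity
  set R := |a| + |b| + 4 with hR
  have hR4 : 4 ≤ R := by linarith [abs_nonneg a, abs_nonneg b]
  set E := exp (R ^ 2 / 4) with hE
  set C := 2 * R * E with hC
  have hE0 : 0 < E := exp_pos _
  have hC0 : 0 < C := by positivity
  have hz : ∀ z ∈ Icc a (a + η), |z| ≤ R ∧ ∃ t, |t| ≤ R ∧ Θ t = Θ z + β := by
    intro z hz
    have hη1 : η ≤ 1 := min_le_right _ _
    have hηδ : η < δ := (min_le_left _ _).trans_lt (half_lt_self hδ)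
    have h1 := neg_abs_le a
    have h2 := le_abs_self a
    have h3 := neg_abs_le b
    have h4 := le_abs_self b
    have h5 := abs_nonneg a
    have h6 := abs_nonneg b
    refine ⟨abs_le.2 ⟨by linarith [hz.1], by linarith [hz.2]⟩, ?_⟩
    have hd : dist (Θ z) (Θ a) < min β (Θ b - Θ a - β) := by
      refine hnear ?_
      rw [Real.dist_eq, abs_lt]
      exact ⟨by linarith [hz.1], by linarith [hz.2]⟩
    rw [Real.dist_eq, lt_min_iff, abs_lt, abs_lt] at hd
    obtain ⟨t, ht, hte⟩ := intermediate_value_uIcc (a := a) (b := b) hΘ.continuousOn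
      (show Θ z + β ∈ uIcc (Θ a) (Θ b) by
        rw [uIcc_of_le (by linarith)]
        exact ⟨by linarith [hd.1.1], by linarith [hd.2.2]⟩)
    refine ⟨t, ?_, hte⟩
    rcases mem_uIcc.1 ht with ht | ht <;>
      exact abs_le.2 ⟨by linarith [ht.1, ht.2], by linarith [ht.1, ht.2]⟩
  refine ⟨2 * (2 * R * (2 * E / c) / η) + 2 * (2 * R * (2 * E / c * C + 2 * C)) + 2,
    by positivity, fun v hv => ?_⟩
  set D := gaussDefect σ v with hD
  set Q := transverse ω v with hQ
  have hD0 : 0 ≤ D := gaussDefect_nonneg σ v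
  have hQ0 : 0 ≤ Q := hv.transverse_nonneg
  set m : ℝ → ℝ := fun t => ∫ p, ‖v (t, p)‖ ^ 2 with hm
  set ex : ℝ → ℝ := fun t => excess ω fun p => v (t, p) with hex
  have hex0 : ∀ t, 0 ≤ ex t := fun t => excess_nonneg (hv.fiber t)
  have hexi : Integrable ex := hv.integrable_excess
  have hS : ∀ z ∈ Icc a (a + η), ∫ t in Icc (-R) R, m t
      ≤ 2 * R * (2 * E / c) * ex z + 2 * R * (2 * E / c * C + 2 * C) * D := by
    intro z hzI
    obtain ⟨hzR, t₁, ht₁, hte⟩ := hz z hzI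
    have h1 := hcoer _ (hv.fiber z)
    have h2 := hv.exit_le hω hσ h ht₁ hzR hte
    have h3 : m z ≤ (ex z + C * D) / c := by
      rw [le_div_iff₀ hc0, mul_comm]
      linarith
    have h4 : ∀ t ∈ Icc (-R) R, m t ≤ 2 * E * ((ex z + C * D) / c) + 2 * (C * D) := by
      intro t ht
      refine (hv.mass_le hσ h (abs_le.2 ht) hzR).trans ?_
      gcongr
    calc ∫ t in Icc (-R) R, m t
        ≤ ∫ t in Icc (-R) R, (2 * E * ((ex z + C * D) / c) + 2 * (C * D)) :=
          setIntegral_mono_on hv.integrable_mass.integrableOn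
            (continuous_const.integrableOn_Icc) measurableSet_Icc h4
      _ = 2 * R * (2 * E * ((ex z + C * D) / c) + 2 * (C * D)) := by
          rw [setIntegral_const, Real.volume_real_Icc_of_le (by linarith), smul_eq_mul]
          ring
      _ = _ := by ring
  have hint : η * ∫ t in Icc (-R) R, m t
      ≤ 2 * R * (2 * E / c) * Q + η * (2 * R * (2 * E / c * C + 2 * C) * D) := by
    have hi1 : IntegrableOn (fun z => 2 * R * (2 * E / c) * ex z) (Icc a (a + η)) :=
      (hexi.const_mul _).integrableOn
    have hi2 : IntegrableOn (fun _ => 2 * R * (2 * E / c * C + 2 * C) * D) (Icc a (a + η)) :=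
      continuous_const.integrableOn_Icc
    have hi3 : IntegrableOn (fun z => 2 * R * (2 * E / c) * ex z
        + 2 * R * (2 * E / c * C + 2 * C) * D) (Icc a (a + η)) := hi1.add hi2
    have hmono := setIntegral_mono_on (μ := volume) (s := Icc a (a + η))
      (continuous_const.integrableOn_Icc) hi3 measurableSet_Icc hS
    rw [setIntegral_const, Real.volume_real_Icc_of_le (by linarith), smul_eq_mul,
      integral_add hi1 hi2,
      integral_const_mul, setIntegral_const, Real.volume_real_Icc_of_le (by linarith),
      smul_eq_mul, add_sub_cancel_left] at hmono
    refine hmono.trans ?_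
    have : ∫ t in Icc a (a + η), ex t ≤ Q := by
      rw [hQ, hv.transverse_eq]
      exact setIntegral_le_integral hexi (Eventually.of_forall hex0)
    gcongr
  have hloc := hv.localize hσ h hR4
  have hfin : ∫ t in Icc (-R) R, m t
      ≤ 2 * R * (2 * E / c) / η * Q + 2 * R * (2 * E / c * C + 2 * C) * D := by
    refine le_of_mul_le_mul_left (hint.trans_eq ?_) hη0
    field_simp
  set k₁ := 2 * R * (2 * E / c) / η
  set k₂ := 2 * R * (2 * E / c * C + 2 * C)
  have hk₁ : 0 ≤ k₁ := by positivity
  have hk₂ : 0 ≤ k₂ := by positivity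
  nlinarith [mul_nonneg hk₁ hD0, mul_nonneg hk₂ hQ0]

end

section
variable {ω : Set (ℝ × ℝ)}

/-- The angular derivative of a planar function. -/
def dtau (f : ℝ × ℝ → ℂ) (p : ℝ × ℝ) : ℂ := fderiv ℝ f p (p.2, -p.1)

lemma PlaneTest.continuous_dtau {f : ℝ × ℝ → ℂ} (hf : PlaneTest ω f) : Continuous (dtau f) :=
  (hf.smooth.continuous_fderiv (by simp)).clm_apply (by fun_prop)

lemma PlaneTest.integrable_dtau {f : ℝ × ℝ → ℂ} (hf : PlaneTest ω f) :
    Integrable fun p => ‖dtau f p‖ ^ 2 :=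
  integrable_norm_sq hf.continuous_dtau
    ((hf.compact.fderiv ℝ).mono' fun p hp => subset_tsupport _ fun h => hp (by simp [dtau, h]))

lemma excess_smul_comp_rot {f : ℝ × ℝ → ℂ} (hf : PlaneTest ω f) (c a : ℝ) :
    excess ω (fun p => c • f (rot a p)) = c ^ 2 * excess ω f := by
  have hd : ∀ p, HasFDerivAt (fun p => c • f (rot a p)) (c • (fderiv ℝ f (rot a p)).comp
      ((cos a • ContinuousLinearMap.fst ℝ ℝ ℝ + sin a • ContinuousLinearMap.snd ℝ ℝ ℝ).prod
        (-sin a • ContinuousLinearMap.fst ℝ ℝ ℝ + cos a • ContinuousLinearMap.snd ℝ ℝ ℝ))) p := by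
    intro p
    refine ((hf.diff _).hasFDerivAt.comp p ?_).const_smul c
    set l := (cos a • ContinuousLinearMap.fst ℝ ℝ ℝ + sin a • ContinuousLinearMap.snd ℝ ℝ ℝ).prod
      (-sin a • ContinuousLinearMap.fst ℝ ℝ ℝ + cos a • ContinuousLinearMap.snd ℝ ℝ ℝ) with hl
    have : rot a = l := by
      ext p <;> simp [hl, rot] <;> ring
    rw [this]
    exact l.hasFDerivAt
  have hx : ∀ p, dx (fun p => c • f (rot a p)) p
      = c • (cos a • dx f (rot a p) - sin a • dy f (rot a p)) := by
    intro p
    rw [dx, (hd p).fderiv, dx, dy, ← map_smul, ← map_smul, ← map_sub]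
    simp
  have hy : ∀ p, dy (fun p => c • f (rot a p)) p
      = c • (sin a • dx f (rot a p) + cos a • dy f (rot a p)) := by
    intro p
    rw [dy, (hd p).fderiv, dx, dy, ← map_smul, ← map_smul, ← map_add]
    simp
  have hn : ∀ p, ‖dx (fun p => c • f (rot a p)) p‖ ^ 2 + ‖dy (fun p => c • f (rot a p)) p‖ ^ 2
      = c ^ 2 * (‖dx f (rot a p)‖ ^ 2 + ‖dy f (rot a p)‖ ^ 2) := by
    intro p
    rw [hx, hy, norm_smul, norm_smul, mul_pow, mul_pow, norm_add_sq_real, norm_sub_sq_real]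
    simp only [norm_smul, mul_pow, Real.norm_eq_abs, sq_abs, inner_smul_left, inner_smul_right]
    have := sin_sq_add_cos_sq a
    simp only [conj_trivial]
    linear_combination (c ^ 2 * (‖dx f (rot a p)‖ ^ 2 + ‖dy f (rot a p)‖ ^ 2)) * this
  simp only [excess, hn, norm_smul, mul_pow, Real.norm_eq_abs, sq_abs, integral_const_mul]
  rw [integral_comp_rot a fun p => ‖dx f p‖ ^ 2 + ‖dy f p‖ ^ 2,
    integral_comp_rot a fun p => ‖f p‖ ^ 2]
  ring

/-- A function on the tube of product type in the straightened coordinates. -/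
def tubeProduct (k Ψ : ℝ → ℝ) (f : ℝ × ℝ → ℂ) (x : ℝ × ℝ × ℝ) : ℂ :=
  k x.1 • f (rot (Ψ x.1) x.2)

section
variable {k k' Ψ : ℝ → ℝ} {f : ℝ × ℝ → ℂ}

lemma tubeProduct_twist (hΨ : Continuous Ψ) (t : ℝ) (p : ℝ × ℝ) :
    tubeProduct k Ψ f (twist Ψ hΨ (t, p)) = k t • f p := by
  simp [tubeProduct]

lemma isTest3_tubeProduct (hk : ContDiff ℝ (⊤ : ℕ∞) k) (hks : HasCompactSupport k)
    (hΨ : ContDiff ℝ (⊤ : ℕ∞) Ψ) (hf : PlaneTest ω f)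
    (hrot : ∀ t p, rot (Ψ t) p ∈ ω → p ∈ ω) : IsTest3 (Omega0 ω) (tubeProduct k Ψ f) := by
  have hrs : ContDiff ℝ (⊤ : ℕ∞) fun x : ℝ × ℝ × ℝ => rot (Ψ x.1) x.2 := by
    unfold rot; fun_prop
  refine ⟨(hk.comp contDiff_fst).smul (hf.smooth.comp hrs), ?_, ?_⟩
  · have h1 : HasCompactSupport fun x : ℝ × ℝ × ℝ => k x.1 • f x.2 := by
      refine HasCompactSupport.intro (hks.isCompact.prod hf.compact.isCompact) fun x hx => ?_
      rw [mem_prod, not_and_or] at hx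
      rcases hx with hx | hx
      · simp [image_eq_zero_of_notMem_tsupport hx]
      · simp [image_eq_zero_of_notMem_tsupport hx]
    have h2 := h1.comp_isClosedEmbedding (twist Ψ hΨ.continuous).symm.isClosedEmbedding
    exact h2
  · intro x hx
    have h1 := tsupport_smul_subset_right (fun x : ℝ × ℝ × ℝ => k x.1)
      (fun x => f (rot (Ψ x.1) x.2)) hx
    exact hrot x.1 x.2 (hf.supp (tsupport_comp_subset_preimage f hrs.continuous h1))

lemma integral_tubeProduct (hΨ : Continuous Ψ) :
    ∫ x, ‖tubeProduct k Ψ f x‖ ^ 2 = (∫ t, k t ^ 2) * ∫ p, ‖f p‖ ^ 2 := by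
  rw [← integral_comp_twist hΨ, Measure.volume_eq_prod, ← integral_prod_mul]
  congr 1; ext x
  rw [show x = (x.1, x.2) from rfl, tubeProduct_twist, norm_smul, mul_pow, Real.norm_eq_abs, sq_abs]

lemma transverse_tubeProduct (hv : IsTest3 (Omega0 ω) (tubeProduct k Ψ f)) (hf : PlaneTest ω f) :
    transverse ω (tubeProduct k Ψ f) = (∫ t, k t ^ 2) * excess ω f := by
  rw [hv.transverse_eq, ← integral_mul_const]
  congr 1; ext t
  exact excess_smul_comp_rot hf (k t) (Ψ t)

lemma pdtau_tubeProduct (hv : Differentiable ℝ (tubeProduct k Ψ f)) (hf : PlaneTest ω f)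
    (t : ℝ) (q : ℝ × ℝ) :
    pdtau (tubeProduct k Ψ f) (t, q) = k t • dtau f (rot (Ψ t) q) := by
  have h1 : HasDerivAt (fun α => tubeProduct k Ψ f (t, rot α q))
      (pdtau (tubeProduct k Ψ f) (t, q)) 0 := by
    have e : pdtau (tubeProduct k Ψ f) (t, q)
        = fderiv ℝ (tubeProduct k Ψ f) (t, rot 0 q) (0, q.2, -q.1) := by
      rw [pdtau, pd2_eq hv, pd3_eq hv, ← map_smul, ← map_smul, ← map_sub, rot_zero]
      simp
    rw [e]
    refine (hv _).hasFDerivAt.comp_hasDerivAt (0 : ℝ) ?_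
    refine ((hasDerivAt_const (0 : ℝ) t).prodMk (hasDerivAt_rot (hasDerivAt_id (0 : ℝ)) q)).congr_deriv ?_
    simp
  have h2 : HasDerivAt (fun α => tubeProduct k Ψ f (t, rot α q))
      (k t • dtau f (rot (Ψ t) q)) 0 := by
    have e : (fun α => tubeProduct k Ψ f (t, rot α q))
        = fun α => k t • f (rot α (rot (Ψ t) q)) := by
      ext α; simp [tubeProduct, rot_rot, add_comm]
    rw [e]
    refine HasDerivAt.const_smul (k t) ?_
    have : dtau f (rot (Ψ t) q) = fderiv ℝ f (rot 0 (rot (Ψ t) q))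
        ((rot (Ψ t) q).2, -(rot (Ψ t) q).1) := by rw [rot_zero, dtau]
    rw [this]
    refine (hf.diff _).hasFDerivAt.comp_hasDerivAt (0 : ℝ) ?_
    exact (hasDerivAt_rot (hasDerivAt_id (0 : ℝ)) (rot (Ψ t) q)).congr_deriv (by simp)
  exact h1.unique h2

lemma transport_tubeProduct (hv : Differentiable ℝ (tubeProduct k Ψ f)) (hf : PlaneTest ω f)
    {Ψ' : ℝ → ℝ} (hΨ : Continuous Ψ) (hk : ∀ t, HasDerivAt k (k' t) t)
    (hΨ' : ∀ t, HasDerivAt Ψ (Ψ' t) t) (σ : ℝ → ℝ) (t : ℝ) (p : ℝ × ℝ) :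
    transport σ (tubeProduct k Ψ f) (twist Ψ hΨ (t, p))
      = k' t • f p + ((Ψ' t - σ t) * k t) • dtau f p := by
  have h1 : transport Ψ' (tubeProduct k Ψ f) (twist Ψ hΨ (t, p)) = k' t • f p := by
    refine (hasDerivAt_comp_twist hv hΨ hΨ' p t).unique ?_
    simp only [tubeProduct_twist]
    exact (hk t).smul_const (f p)
  have h2 := pdtau_tubeProduct hv hf t (rot (-Ψ t) p)
  rw [rot_rot_neg] at h2
  rw [← h1, transport, transport, twist_apply, h2, smul_smul, smul_smul]
  rw [sub_mul, sub_smul]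
  abel

lemma gaussDefect_tubeProduct_le (hv : Differentiable ℝ (tubeProduct k Ψ f)) (hf : PlaneTest ω f)
    {Ψ' : ℝ → ℝ} (hΨ : Continuous Ψ) (hk : ∀ t, HasDerivAt k (k' t) t) (hk' : Continuous k')
    (hks : HasCompactSupport k) (hΨ' : ∀ t, HasDerivAt Ψ (Ψ' t) t) (σ : ℝ → ℝ) {ε : ℝ}
    (hε : ∀ t, k t ≠ 0 → |Ψ' t - σ t| ≤ ε) :
    gaussDefect σ (tubeProduct k Ψ f)
      ≤ 2 * ((∫ t, (k' t + t / 4 * k t) ^ 2) * ∫ p, ‖f p‖ ^ 2)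
        + 2 * ε ^ 2 * ((∫ t, k t ^ 2) * ∫ p, ‖dtau f p‖ ^ 2) := by
  have hkc : Continuous k := continuous_iff_continuousAt.2 fun t => (hk t).continuousAt
  have hk_supp : HasCompactSupport k' := (funext fun t => (hk t).deriv : deriv k = k') ▸ hks.deriv
  have i1 : Integrable fun t => (k' t + t / 4 * k t) ^ 2 :=
    Continuous.integrable_of_hasCompactSupport (by fun_prop)
      ((hk_supp.add (hks.mul_left (f := fun t => t / 4))).comp_left (g := fun z => z ^ 2) (by simp))
  have i2 : Integrable fun t => k t ^ 2 :=
    Continuous.integrable_of_hasCompactSupport (by fun_prop)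
      (hks.comp_left (g := fun z => z ^ 2) (by simp))
  have j1 := (i1.mul_prod hf.integrable).const_mul 2
  have j2 := (i2.mul_prod hf.integrable_dtau).const_mul (2 * ε ^ 2)
  rw [← integral_prod_mul, ← integral_prod_mul, ← integral_const_mul, ← integral_const_mul,
    ← integral_add j1 j2, gaussDefect, ← integral_comp_twist hΨ, Measure.volume_eq_prod]
  refine integral_mono_of_nonneg (Eventually.of_forall fun x => by positivity) (j1.add j2)
    (Eventually.of_forall fun x => ?_)
  obtain ⟨t, p⟩ := x
  simp only
  rw [transport_tubeProduct hv hf hΨ hk hΨ', tubeProduct_twist]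
  have e : k' t • f p + ((Ψ' t - σ t) * k t) • dtau f p + ((twist Ψ hΨ (t, p)).1 / 4) • k t • f p
      = (k' t + t / 4 * k t) • f p + ((Ψ' t - σ t) * k t) • dtau f p := by
    rw [add_smul, smul_smul, twist_apply]; abel
  rw [e]
  have h1 := norm_add_le ((k' t + t / 4 * k t) • f p) (((Ψ' t - σ t) * k t) • dtau f p)
  have h2 : ‖(k' t + t / 4 * k t) • f p‖ ^ 2 = (k' t + t / 4 * k t) ^ 2 * ‖f p‖ ^ 2 := by
    rw [norm_smul, mul_pow, Real.norm_eq_abs, sq_abs]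
  have h3 : ‖((Ψ' t - σ t) * k t) • dtau f p‖ ^ 2 ≤ ε ^ 2 * (k t ^ 2 * ‖dtau f p‖ ^ 2) := by
    rw [norm_smul, mul_pow, Real.norm_eq_abs, sq_abs, mul_pow, mul_assoc]
    by_cases h0 : k t = 0
    · simp [h0]
    · gcongr ?_ * _
      rw [← sq_abs]
      gcongr
      exact hε t h0
  have h4 : ‖(k' t + t / 4 * k t) • f p + ((Ψ' t - σ t) * k t) • dtau f p‖ ^ 2
      ≤ 2 * ‖(k' t + t / 4 * k t) • f p‖ ^ 2 + 2 * ‖((Ψ' t - σ t) * k t) • dtau f p‖ ^ 2 := by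
    nlinarith [norm_nonneg ((k' t + t / 4 * k t) • f p + ((Ψ' t - σ t) * k t) • dtau f p),
      sq_nonneg (‖(k' t + t / 4 * k t) • f p‖ - ‖((Ψ' t - σ t) * k t) • dtau f p‖)]
  rw [h2] at h4
  linarith

end

/-- Truncated Gaussians have small defect. -/
lemma exists_truncated_gaussian {δ : ℝ} (hδ : 0 < δ) :
    ∃ k k' : ℝ → ℝ, ContDiff ℝ (⊤ : ℕ∞) k ∧ HasCompactSupport k ∧
      (∀ t, HasDerivAt k (k' t) t) ∧ Continuous k' ∧ 0 < ∫ t, k t ^ 2 ∧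
      ∫ t, (k' t + t / 4 * k t) ^ 2 ≤ δ * ∫ t, k t ^ 2 := by
  let χ : ContDiffBump (0 : ℝ) := ⟨1, 2, one_pos, one_lt_two⟩
  have hχ : ContDiff ℝ (⊤ : ℕ∞) (χ : ℝ → ℝ) := χ.contDiff
  have hχd : ∀ t, HasDerivAt χ (deriv χ t) t := fun t =>
    (hχ.differentiable (by simp) t).hasDerivAt
  have hχ'c : Continuous (deriv χ) := hχ.continuous_deriv (by simp)
  obtain ⟨B, hB⟩ := χ.hasCompactSupport.deriv.exists_bound_of_continuous hχ'c
  have hG : Integrable fun t : ℝ => exp (-(1 / 4) * t ^ 2) :=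
    integrable_exp_neg_mul_sq (by norm_num)
  set G := ∫ t : ℝ, exp (-(1 / 4) * t ^ 2) with hGdef
  set m := 2 * exp (-(1 / 4)) with hm
  have hm0 : 0 < m := by positivity
  obtain ⟨n, hn⟩ := exists_nat_gt (B ^ 2 * G / (δ * m))
  set N : ℝ := (n : ℝ) + 1 with hN
  have hN1 : 1 ≤ N := by simp [hN]
  have hN0 : 0 < N := by positivity
  have hNb : B ^ 2 * G / N ^ 2 ≤ δ * m := by
    rw [div_lt_iff₀ (by positivity)] at hn
    rw [div_le_iff₀ (by positivity)]
    have h1 : (n : ℝ) ≤ N ^ 2 := by nlinarith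
    have h2 : 0 < δ * m := by positivity
    nlinarith
  set k : ℝ → ℝ := fun t => exp (-(t ^ 2 / 8)) * χ (t / N) with hk
  set k' : ℝ → ℝ := fun t => exp (-(t ^ 2 / 8)) * (deriv χ (t / N) / N - t / 4 * χ (t / N)) with hk'
  have hks : ContDiff ℝ (⊤ : ℕ∞) k := by fun_prop
  have hkc : HasCompactSupport k := by
    refine HasCompactSupport.mul_left ?_
    exact χ.hasCompactSupport.comp_homeomorph (Homeomorph.mulRight₀ N⁻¹ (inv_ne_zero hN0.ne'))
  have hχc := χ.continuous
  have hkd : ∀ t, HasDerivAt k (k' t) t := by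
    intro t
    have h1 : HasDerivAt (fun t : ℝ => exp (-(t ^ 2 / 8))) (exp (-(t ^ 2 / 8)) * -(t / 4)) t :=
      (((hasDerivAt_id t).pow 2).div_const 8).neg.exp.congr_deriv (by simp; ring)
    have h2 : HasDerivAt (fun t => χ (t / N)) (deriv χ (t / N) * (1 / N)) t :=
      HasDerivAt.comp (h₂ := (χ : ℝ → ℝ)) (h := fun t => t / N) t (hχd (t / N))
        ((hasDerivAt_id t).div_const N)
    refine (h1.mul h2).congr_deriv ?_
    simp only [hk']; ring
  have ik : Integrable fun t => k t ^ 2 :=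
    Continuous.integrable_of_hasCompactSupport (by fun_prop)
      (hkc.comp_left (g := fun z => z ^ 2) (by simp))
  have hlow : m ≤ ∫ t, k t ^ 2 := by
    calc m = ∫ t in Icc (-1 : ℝ) 1, exp (-(1 / 4)) := by
          rw [setIntegral_const, Real.volume_real_Icc_of_le (by norm_num), smul_eq_mul, hm]
          norm_num
      _ ≤ ∫ t in Icc (-1 : ℝ) 1, k t ^ 2 := by
          refine setIntegral_mono_on continuous_const.integrableOn_Icc ik.integrableOn
            measurableSet_Icc fun t ht => ?_
          have h1 : χ (t / N) = 1 := by
            refine χ.one_of_mem_closedBall ?_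
            rw [mem_closedBall_zero_iff, Real.norm_eq_abs, abs_div, abs_of_pos hN0]
            exact div_le_one_of_le₀ ((abs_le.2 ht).trans hN1) hN0.le
          simp only [hk, h1, mul_one, ← exp_nat_mul]
          have : t ^ 2 ≤ 1 := by nlinarith [ht.1, ht.2]
          gcongr
          push_cast; linarith
      _ ≤ ∫ t, k t ^ 2 := setIntegral_le_integral ik (Eventually.of_forall fun t => by positivity)
  refine ⟨k, k', hks, hkc, hkd, by fun_prop, hm0.trans_le hlow, ?_⟩
  calc ∫ t, (k' t + t / 4 * k t) ^ 2
      ≤ ∫ t : ℝ, B ^ 2 / N ^ 2 * exp (-(1 / 4) * t ^ 2) := by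
        refine integral_mono_of_nonneg (Eventually.of_forall fun t => by positivity)
          (hG.const_mul _) (Eventually.of_forall fun t => ?_)
        have e : k' t + t / 4 * k t = exp (-(t ^ 2 / 8)) * (deriv χ (t / N) / N) := by
          simp only [hk, hk']; ring
        simp only [e]
        rw [mul_pow, ← exp_nat_mul, div_pow, mul_comm]
        have h1 : deriv χ (t / N) ^ 2 ≤ B ^ 2 := by
          rw [← sq_abs]
          have := hB (t / N)
          rw [Real.norm_eq_abs] at this
          gcongr
        have h2 : exp (((2 : ℕ) : ℝ) * -(t ^ 2 / 8)) = exp (-(1 / 4) * t ^ 2) := by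
          congr 1; push_cast; ring
        rw [h2]
        gcongr
    _ = B ^ 2 * G / N ^ 2 := by rw [integral_const_mul]; ring
    _ ≤ δ * m := hNb
    _ ≤ _ := by gcongr

end

section
variable {ω : Set (ℝ × ℝ)}

lemma hasDerivAt_comp_exp_mul {θ : ℝ → ℝ} (hθ : Differentiable ℝ θ) (s t : ℝ) :
    HasDerivAt (fun t => θ (exp (s / 2) * t)) (sigmafun θ s t) t := by
  have h := (hθ (exp (s / 2) * t)).hasDerivAt.comp t ((hasDerivAt_id t).const_mul (exp (s / 2)))
  exact h.congr_deriv (by simp [sigmafun, mul_comm])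

lemma continuous_sigmafun {θ : ℝ → ℝ} (hθ : ContDiff ℝ 1 θ) (s : ℝ) :
    Continuous (sigmafun θ s) := by
  have := hθ.continuous_deriv le_rfl
  unfold sigmafun
  fun_prop

lemma IsTest3.integral_pos {v : ℝ × ℝ × ℝ → ℂ} (hv : IsTest3 (Omega0 ω) v) (h0 : v ≠ 0) :
    0 < ∫ y in Omega0 ω, ‖v y‖ ^ 2 := by
  rw [hv.setIntegral_eq (g := fun x => ‖v x‖ ^ 2) fun x h _ => by simp [h]]
  obtain ⟨p, hp⟩ := Function.ne_iff.1 h0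
  exact (hv.1.continuous.norm.pow 2).integral_pos_of_hasCompactSupport_nonneg_nonzero
    hv.2.1.norm_sq (fun p => by positivity) (x := p) (by simpa using hp)

lemma exists_planeTest_ne_zero (hω : IsOpen ω) (hne : ω.Nonempty) :
    ∃ f : ℝ × ℝ → ℂ, PlaneTest ω f ∧ f ≠ 0 := by
  obtain ⟨p, hp⟩ := hne
  obtain ⟨f, hf1, hf2, hf3, -, hf5⟩ := exists_contDiff_tsupport_subset (n := (⊤ : ℕ∞))
    (hω.mem_nhds hp)
  have hf : PlaneTest ω f := ⟨hf3, hf2, hf1⟩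
  exact ⟨fun p => (f p : ℂ), hf.ofReal, Function.ne_iff.2 ⟨p, by simp [hf5]⟩⟩

lemma exists_excess_le (hω : IsOpen ω) (hne : ω.Nonempty) {δ : ℝ} (hδ : 0 < δ) :
    ∃ f : ℝ × ℝ → ℂ, PlaneTest ω f ∧ 0 < ∫ p, ‖f p‖ ^ 2 ∧ excess ω f ≤ δ * ∫ p, ‖f p‖ ^ 2 := by
  obtain ⟨f₀, hf₀, h₀⟩ := exists_planeTest_ne_zero hω hne
  obtain ⟨r, ⟨f, hf, h0, rfl⟩, hr⟩ := exists_lt_of_csInf_lt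
    (s := {r : ℝ | ∃ f : ℝ × ℝ → ℂ, IsTest2 ω f ∧ f ≠ 0 ∧
      r = (∫ p in ω, (‖pd1' f p‖ ^ 2 + ‖pd2' f p‖ ^ 2)) / ∫ p in ω, ‖f p‖ ^ 2})
    ⟨_, f₀, ⟨hf₀.smooth, hf₀.compact, hf₀.supp⟩, h₀, rfl⟩ (lt_add_of_pos_right (E1 ω) hδ)
  have hf : PlaneTest ω f := ⟨hf.1, hf.2.1, hf.2.2⟩
  have hpos := hf.integral_pos h0
  rw [hf.rayleigh_eq, div_lt_iff₀ hpos] at hr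
  refine ⟨f, hf, hpos, ?_⟩
  unfold excess
  linarith

lemma le_Jform {θ : ℝ → ℝ} (hθ : ContDiff ℝ 1 θ) {s : ℝ} (hs : 0 ≤ s) {v : ℝ × ℝ × ℝ → ℂ}
    (hv : IsTest3 (Omega0 ω) v) :
    1 / 4 * (∫ x, ‖v x‖ ^ 2) + (gaussDefect (sigmafun θ s) v + transverse ω v)
      ≤ Jform θ ω s v := by
  rw [hv.Jform_eq (continuous_sigmafun hθ s)
    (hasDerivAt_comp_exp_mul (hθ.differentiable one_ne_zero) s)]
  nlinarith [Real.one_le_exp hs, hv.transverse_nonneg]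

/-- Continuous functions are uniformly approximated on bounded sets by derivatives of smooth functions. -/
lemma exists_smooth_primitive_near {σ : ℝ → ℝ} (hσ : Continuous σ) {S : Set ℝ}
    (hS : Bornology.IsBounded S) {ε : ℝ} (hε : 0 < ε) :
    ∃ Ψ Ψ' : ℝ → ℝ, ContDiff ℝ (⊤ : ℕ∞) Ψ ∧ (∀ t, HasDerivAt Ψ (Ψ' t) t) ∧
      ∀ t ∈ S, |Ψ' t - σ t| ≤ ε := by
  obtain ⟨L, hL⟩ := hS.subset_closedBall 0
  rw [Real.closedBall_eq_Icc] at hL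
  obtain ⟨q, hq⟩ := exists_polynomial_near_of_continuousOn (0 - L) (0 + L) σ hσ.continuousOn ε hε
  have hqc : ContDiff ℝ (⊤ : ℕ∞) fun t => q.eval t := by
    simpa using q.contDiff_aeval (𝕜 := ℝ) (⊤ : ℕ∞)
  have hd : ∀ t, HasDerivAt (fun t => ∫ u in (0 : ℝ)..t, q.eval u) (q.eval t) t := fun t =>
    intervalIntegral.integral_hasDerivAt_right (hqc.continuous.intervalIntegrable _ _)
      hqc.continuous.stronglyMeasurable.stronglyMeasurableAtFilter hqc.continuous.continuousAt
  refine ⟨_, _, ?_, hd, fun t ht => (hq t (hL ht)).le⟩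
  rw [contDiff_infty_iff_deriv]
  refine ⟨fun t => (hd t).differentiableAt, ?_⟩
  rwa [funext fun t => (hd t).deriv]

lemma exists_admissible_angle {θ : ℝ → ℝ} (hθ : ContDiff ℝ 1 θ) (h : Untwisted θ ω) (s : ℝ)
    {S : Set ℝ} (hS : Bornology.IsBounded S) {ε : ℝ} (hε : 0 < ε) :
    ∃ Ψ Ψ' : ℝ → ℝ, ContDiff ℝ (⊤ : ℕ∞) Ψ ∧ (∀ t, HasDerivAt Ψ (Ψ' t) t) ∧
      (∀ t ∈ S, |Ψ' t - sigmafun θ s t| ≤ ε) ∧ ∀ t p, rot (Ψ t) p ∈ ω → p ∈ ω := by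
  rcases h with h | h
  · have e : θ = fun _ => θ 0 := funext fun t => h t 0
    refine ⟨fun _ => 0, fun _ => 0, contDiff_const, fun t => hasDerivAt_const t 0, fun t _ => ?_,
      fun t p hp => by rwa [rot_zero] at hp⟩
    have : sigmafun θ s t = 0 := by rw [sigmafun, e, deriv_const, mul_zero]
    simp [this, hε.le]
  · obtain ⟨Ψ, Ψ', h1, h2, h3⟩ := exists_smooth_primitive_near (continuous_sigmafun hθ s) hS hε
    refine ⟨Ψ, Ψ', h1, h2, h3, fun t p hp => ?_⟩
    rw [← h (-Ψ t)]
    exact ⟨_, hp, rot_neg_rot _ _⟩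

lemma exists_Jform_le (hω : IsOpen ω) (hne : ω.Nonempty) {θ : ℝ → ℝ} (hθ : ContDiff ℝ 1 θ)
    (h : Untwisted θ ω) (s : ℝ) {δ : ℝ} (hδ : 0 < δ) :
    ∃ v : ℝ × ℝ × ℝ → ℂ, IsTest3 (Omega0 ω) v ∧ 0 < ∫ x, ‖v x‖ ^ 2 ∧
      Jform θ ω s v ≤ (1 / 4 + (3 + exp s) * δ) * ∫ x, ‖v x‖ ^ 2 := by
  obtain ⟨f, hf, hfpos, hfe⟩ := exists_excess_le hω hne hδ
  obtain ⟨k, k', hk, hks, hkd, hk', hkpos, hkδ⟩ := exists_truncated_gaussian hδ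
  set F := ∫ p, ‖f p‖ ^ 2
  set K := ∫ t, k t ^ 2
  set D := ∫ p, ‖dtau f p‖ ^ 2
  have hD : 0 ≤ D := integral_nonneg fun p => by positivity
  obtain ⟨ε, hε, hεD⟩ : ∃ ε > 0, 2 * ε ^ 2 * D ≤ δ * F := by
    refine ⟨√(δ * F / (2 * (D + 1))), Real.sqrt_pos.2 (by positivity), ?_⟩
    rw [Real.sq_sqrt (by positivity)]
    have : 2 * (δ * F / (2 * (D + 1))) * D = δ * F * (D / (D + 1)) := by field_simp
    rw [this]
    exact mul_le_of_le_one_right (by positivity) (div_le_one_of_le₀ (by linarith) (by linarith))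
  obtain ⟨Ψ, Ψ', hΨ, hΨd, hΨε, hrot⟩ := exists_admissible_angle hθ h s hks.isCompact.isBounded hε
  have hv := isTest3_tubeProduct hk hks hΨ hf hrot
  have hM := integral_tubeProduct (k := k) (f := f) hΨ.continuous
  refine ⟨_, hv, by rw [hM]; positivity, ?_⟩
  have hg := gaussDefect_tubeProduct_le hv.diff hf hΨ.continuous hkd hk' hks hΨd (sigmafun θ s)
    (ε := ε) fun t ht => hΨε t (subset_tsupport _ ht)
  rw [hv.Jform_eq (continuous_sigmafun hθ s)
    (hasDerivAt_comp_exp_mul (hθ.differentiable one_ne_zero) s), transverse_tubeProduct hv hf, hM]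
  have h1 := mul_le_mul_of_nonneg_right hkδ hfpos.le
  have h2 := mul_le_mul_of_nonneg_left hεD hkpos.le
  have h3 := mul_le_mul_of_nonneg_left hfe (mul_nonneg (exp_pos s).le hkpos.le)
  change gaussDefect _ _ ≤ 2 * (_ * F) + 2 * ε ^ 2 * (K * D) at hg
  change 1 / 4 * (K * F) + _ + exp s * (K * excess ω f) ≤ (1 / 4 + (3 + exp s) * δ) * (K * F)
  linarith

lemma le_mu (hω : IsOpen ω) (hne : ω.Nonempty) {θ : ℝ → ℝ} {s c : ℝ}
    (h : ∀ v : ℝ × ℝ × ℝ → ℂ, IsTest3 (Omega0 ω) v → c * (∫ x, ‖v x‖ ^ 2) ≤ Jform θ ω s v) :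
    c ≤ mu θ ω s := by
  refine le_csInf ?_ ?_
  · obtain ⟨f, hf, h0⟩ := exists_planeTest_ne_zero hω hne
    obtain ⟨k, k', hk, hks, -, -, hkpos, -⟩ := exists_truncated_gaussian one_pos
    have hv := isTest3_tubeProduct (Ψ := fun _ => 0) hk hks contDiff_const hf
      fun t p hp => by rwa [rot_zero] at hp
    refine ⟨_, _, hv, fun hv0 => ?_, rfl⟩
    have hM := integral_tubeProduct (k := k) (f := f) (Ψ := fun _ => 0) continuous_const
    rw [hv0] at hM
    have := mul_pos hkpos (hf.integral_pos h0)
    simp [← hM] at this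
  · rintro r ⟨v, hv, h0, rfl⟩
    rw [le_div_iff₀ (hv.integral_pos h0),
      hv.setIntegral_eq (g := fun x => ‖v x‖ ^ 2) fun x h _ => by simp [h]]
    exact h v hv

lemma quarter_le_Jform {θ : ℝ → ℝ} (hθ : ContDiff ℝ 1 θ) {s : ℝ} (hs : 0 ≤ s)
    {v : ℝ × ℝ × ℝ → ℂ} (hv : IsTest3 (Omega0 ω) v) :
    1 / 4 * (∫ x, ‖v x‖ ^ 2) ≤ Jform θ ω s v := by
  linarith [le_Jform hθ hs hv, gaussDefect_nonneg (sigmafun θ s) v, hv.transverse_nonneg]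

lemma mu_le (hω : IsOpen ω) (hne : ω.Nonempty) {θ : ℝ → ℝ} (hθ : ContDiff ℝ 1 θ)
    (h : Untwisted θ ω) {s : ℝ} (hs : 0 ≤ s) : mu θ ω s ≤ 1 / 4 := by
  refine le_of_forall_pos_le_add fun η hη => ?_
  have hc : 0 < 3 + exp s := by positivity
  obtain ⟨v, hv, hpos, hJ⟩ := exists_Jform_le hω hne hθ h s (div_pos hη hc)
  rw [mul_div_cancel₀ _ hc.ne'] at hJ
  have h0 : v ≠ 0 := by rintro rfl; simp at hpos
  have hle : mu θ ω s ≤ Jform θ ω s v / ∫ y in Omega0 ω, ‖v y‖ ^ 2 := by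
    refine csInf_le ⟨1 / 4, ?_⟩ ⟨v, hv, h0, rfl⟩
    rintro r ⟨w, hw, hw0, rfl⟩
    rw [le_div_iff₀ (hw.integral_pos hw0),
      hw.setIntegral_eq (g := fun x => ‖w x‖ ^ 2) fun x h _ => by simp [h]]
    exact quarter_le_Jform hθ hs hw
  refine hle.trans ?_
  rw [div_le_iff₀ (hv.integral_pos h0),
    hv.setIntegral_eq (g := fun x => ‖v x‖ ^ 2) fun x h _ => by simp [h]]
  exact hJ

lemma quarter_lt_mu (hω : IsOpen ω) (hc : IsConnected ω) (hf : volume ω ≠ ⊤) {θ : ℝ → ℝ}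
    (hθ : ContDiff ℝ 1 θ) (h : Twisted θ ω) {s : ℝ} (hs : 0 ≤ s) : 1 / 4 < mu θ ω s := by
  obtain ⟨⟨a, b, hab⟩, ϑ, hϑ, hrot⟩ := h
  wlog hlt : θ a < θ b generalizing a b
  · exact this b a hab.symm (lt_of_le_of_ne (not_lt.1 hlt) hab.symm)
  obtain ⟨β, hβ0, hβ, hA⟩ := exists_rot_diff hω hf hϑ.1 hrot (sub_pos.2 hlt)
  have hr : ∀ c : ℝ, exp (s / 2) * (c / exp (s / 2)) = c := fun c =>
    mul_div_cancel₀ c (exp_ne_zero _)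
  obtain ⟨K, hK, hv⟩ := exists_mass_le hω hc hf (continuous_sigmafun hθ s)
    (hasDerivAt_comp_exp_mul (hθ.differentiable one_ne_zero) s) (a := a / exp (s / 2))
    (b := b / exp (s / 2)) hβ0 (by simpa only [hr] using hβ) hA
  have hlow : 1 / 4 + 1 / K ≤ mu θ ω s := by
    refine le_mu hω hc.nonempty fun v hvt => ?_
    have h1 := hv v hvt
    rw [← div_le_iff₀' hK] at h1
    have h2 := le_Jform hθ hs hvt
    have h3 : (1 / 4 + 1 / K) * (∫ x, ‖v x‖ ^ 2)
        = 1 / 4 * (∫ x, ‖v x‖ ^ 2) + (∫ x, ‖v x‖ ^ 2) / K := by ring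
    linarith
  have : 0 < 1 / K := by positivity
  linarith

end

/-- if the tube is twisted then μ(s) > 1/4 for every s ≥ 0; if the
tube is untwisted then μ(s) = 1/4 for every s ≥ 0. -/
theorem mu_gt_quarter_iff_twisted
    (ω : Set (ℝ × ℝ)) (hω_open : IsOpen ω) (hω_bdd : Bornology.IsBounded ω)
    (hω_conn : IsConnected ω)
    (θ : ℝ → ℝ) (hθ : ContDiff ℝ 1 θ) (hθ' : ∃ M : ℝ, ∀ t : ℝ, |deriv θ t| ≤ M)
    (hsupp : HasCompactSupport (deriv θ)) :
    (Twisted θ ω → ∀ s : ℝ, 0 ≤ s → 1 / 4 < mu θ ω s) ∧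
    (Untwisted θ ω → ∀ s : ℝ, 0 ≤ s → mu θ ω s = 1 / 4) :=
  ⟨fun h _ hs => quarter_lt_mu hω_open hω_conn hω_bdd.measure_lt_top.ne hθ h hs,
    fun h _ hs => le_antisymm (mu_le hω_open hω_conn.nonempty hθ h hs)
      (le_mu hω_open hω_conn.nonempty fun _ hv => quarter_le_Jform hθ hs hv)⟩
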